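/- For every R > 0, the Dirichlet eigenvalues of the open disk B_R of radius R satisfy λ₁(B_R) < λ₂(B_R) = λ₃(B_R) < λ₄(B_R) = λ₅(B_R) < λ₆(B_R). -/

import Mathlib

open MeasureTheory Real Set

noncomputable section

/-- A Dirichlet test function on `ω`: smooth, compactly supported, with support in `ω`. -/
def testFun (ω : Set (ℝ × ℝ)) (u : (ℝ × ℝ) → ℝ) : Prop :=
  ContDiff ℝ (⊤ : ℕ∞) u ∧ HasCompactSupport u ∧ tsupport u ⊆ ω

/-- `|∇u|²` at a point. -/
def gradSq (u : (ℝ × ℝ) → ℝ) (x : ℝ × ℝ) : ℝ :=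
  fderiv ℝ u x (1, 0) ^ 2 + fderiv ℝ u x (0, 1) ^ 2

/-- The Rayleigh quotient of `u` on `ω`. -/
def rayleigh (ω : Set (ℝ × ℝ)) (u : (ℝ × ℝ) → ℝ) : ℝ :=
  (∫ x in ω, gradSq u x) / ∫ x in ω, u x ^ 2

/-- The `k`-th Dirichlet eigenvalue of `ω` (`k ≥ 1`), via the Courant–Fischer
min-max formula over `k`-dimensional subspaces of `C_c^∞(ω)`. -/
def dirichletEV (ω : Set (ℝ × ℝ)) (k : ℕ) : ℝ :=
  sInf {l | ∃ V : Submodule ℝ ((ℝ × ℝ) → ℝ),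
    (V : Set ((ℝ × ℝ) → ℝ)) ⊆ {u | testFun ω u} ∧ Module.finrank ℝ V = k ∧
    l = sSup {r | ∃ u ∈ V, u ≠ 0 ∧ r = rayleigh ω u}}

/-- The open disk `B_R` centered at the origin. -/
def disk (R : ℝ) : Set (ℝ × ℝ) := {x | x.1 ^ 2 + x.2 ^ 2 < R ^ 2}

/-- The open annulus `M_{R₁,R₂} = B_{R₂} \ closure (B_{R₁})`. -/
def annulus (R₁ R₂ : ℝ) : Set (ℝ × ℝ) := disk R₂ \ closure (disk R₁)

/-- `D_{R₁,R₂} = B_{R₁} ∪ M_{R₁,R₂}`. -/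
def diskUnionAnnulus (R₁ R₂ : ℝ) : Set (ℝ × ℝ) := disk R₁ ∪ annulus R₁ R₂

/-- The cracked domain `𝔇(N,ε)`. -/
def crackedDomain (R₁ R₂ : ℝ) (N : ℕ) (ε : ℝ) : Set (ℝ × ℝ) :=
  diskUnionAnnulus R₁ R₂ ∪
    ⋃ j ∈ Finset.range N, {x | ∃ θ : ℝ, θ ∈ Set.Ioo (2 * π * j / N - ε) (2 * π * j / N + ε) ∧
      x = (R₁ * Real.cos θ, R₁ * Real.sin θ)}

/-- The entire function `s ↦ ∑ (-s/4)^k / (k! (n+k)!)`; the Bessel function of the first kind is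
`J_n(r) = (r/2)^n * bes n (r^2)`. -/
def bes (n : ℕ) (s : ℝ) : ℝ := ∑' k : ℕ, (-s / 4) ^ k / (k.factorial * (n + k).factorial)

lemma bes_summable (n : ℕ) (s : ℝ) :
    Summable fun k : ℕ => (-s / 4) ^ k / (k.factorial * (n + k).factorial : ℝ) := by
  refine Summable.of_norm_bounded (Real.summable_pow_div_factorial |(-s / 4)|) fun k => ?_
  rw [norm_div, norm_pow, Real.norm_eq_abs, Real.norm_eq_abs, abs_of_pos (a := (k.factorial * _ : ℝ))
    (by positivity)]
  gcongr
  exact le_mul_of_one_le_right (by positivity) (by exact_mod_cast Nat.one_le_iff_ne_zero.2 (Nat.factorial_ne_zero _))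

lemma bes_zero (n : ℕ) : bes n 0 = 1 / n.factorial := by
  rw [bes, tsum_eq_single 0]
  · simp
  · intro k hk
    simp [hk]

lemma hasDerivAt_bes (n : ℕ) (s : ℝ) : HasDerivAt (bes n) (-bes (n + 1) s / 4) s := by
  have key := hasDerivAt_tsum_of_isPreconnected
    (g := fun (k : ℕ) (s : ℝ) => (-s / 4) ^ k / (k.factorial * (n + k).factorial : ℝ))
    (g' := fun (k : ℕ) (s : ℝ) => (k * (-s / 4) ^ (k - 1) * (-1 / 4)) / (k.factorial * (n + k).factorial : ℝ))
    (u := fun k : ℕ => k * (|s| + 1) ^ (k - 1) / (k.factorial : ℝ))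
    (t := Metric.ball 0 (|s| + 1)) (y₀ := 0) (y := s) ?_ Metric.isOpen_ball
    (convex_ball _ _).isPreconnected ?_ ?_ (by simp; positivity) (bes_summable n 0) (by simp)
  · have hs : HasSum (fun k : ℕ => (k * (-s / 4) ^ (k - 1) * (-1 / 4)) / (k.factorial * (n + k).factorial : ℝ))
        (-bes (n + 1) s / 4) := by
      refine (hasSum_nat_add_iff' 1).1 ?_
      have h := (bes_summable (n + 1) s).hasSum.mul_right (-1 / 4)
      simp only [Finset.range_one, Finset.sum_singleton, CharP.cast_eq_zero, zero_mul, zero_div, sub_zero]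
      rw [show -bes (n + 1) s / 4 = bes (n + 1) s * (-1 / 4) by ring]
      refine h.congr_fun fun k => ?_
      simp only [Nat.add_sub_cancel, Nat.factorial_succ, show n + (k + 1) = n + 1 + k by ring]
      push_cast
      field_simp
    rwa [hs.tsum_eq] at key
  · rw [← summable_nat_add_iff 1]
    refine (Real.summable_pow_div_factorial (|s| + 1)).congr fun k => ?_
    simp only [Nat.add_sub_cancel, Nat.factorial_succ]
    push_cast
    field_simp
  · intro k y _
    have : HasDerivAt (fun s : ℝ => -s / 4) (-1 / 4) y := (hasDerivAt_id y).neg.div_const 4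
    exact (this.pow k).div_const _
  · intro k y hy
    have hy' : |y| < |s| + 1 := by simpa using hy
    rw [norm_div, norm_mul, norm_mul, norm_pow]
    simp only [Real.norm_eq_abs, Nat.abs_cast, abs_mul]
    have h1 : |(-y / 4)| ≤ |s| + 1 := by
      rw [abs_div, abs_neg]; norm_num; linarith [abs_nonneg y]
    have h2 : (1 : ℝ) ≤ (n + k).factorial := by
      exact_mod_cast Nat.one_le_iff_ne_zero.2 (Nat.factorial_ne_zero _)
    have h3 : (k : ℝ) * |(-y / 4)| ^ (k - 1) * |(-1 / 4 : ℝ)| ≤ k * (|s| + 1) ^ (k - 1) * 1 := by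
      gcongr
      norm_num [abs_div]
    rw [mul_one] at h3
    refine div_le_div₀ (by positivity) h3 (by positivity) ?_
    exact le_mul_of_one_le_right (by positivity) h2

lemma bes_rec (n : ℕ) (s : ℝ) : bes n s - (n + 1) * bes (n + 1) s = -(s / 4) * bes (n + 2) s := by
  have h := (bes_summable n s).hasSum.sub ((bes_summable (n + 1) s).hasSum.mul_left ((n : ℝ) + 1))
  have h' := (hasSum_nat_add_iff' 1).2 h
  have h2 := (bes_summable (n + 2) s).hasSum.mul_left (-(s / 4))
  have e := h'.unique (h2.congr_fun ?_)
  · simp only [Finset.range_one, Finset.sum_singleton] at e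
    rw [bes, bes, bes, ← e]
    simp [Nat.factorial_succ]
    field_simp
    ring
  · intro k
    simp only [Nat.factorial_succ, show n + (k + 1) = n + k + 1 by ring, show n + 1 + (k + 1) = n + k + 1 + 1 by ring,
      show n + 2 + k = n + k + 1 + 1 by ring]
    push_cast
    field_simp
    ring

lemma continuous_bes (n : ℕ) : Continuous (bes n) :=
  continuous_iff_continuousAt.2 fun s => (hasDerivAt_bes n s).continuousAt

lemma contDiff_bes (n : ℕ) : ContDiff ℝ (⊤ : ℕ∞) (bes n) := by
  rw [contDiff_infty]
  intro m
  induction m generalizing n with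
  | zero => exact contDiff_zero.2 (continuous_bes n)
  | succ m ih =>
    push_cast
    rw [contDiff_succ_iff_deriv]
    refine ⟨fun s => (hasDerivAt_bes n s).differentiableAt, by simp, ?_⟩
    have : deriv (bes n) = fun s => -bes (n + 1) s / 4 := funext fun s => (hasDerivAt_bes n s).deriv
    rw [this]
    exact (ih (n + 1)).neg.div_const 4

/-- The derivative of `s^{n+1} f_{n+1}` is `s^n f_n`. -/
lemma hasDerivAt_pow_mul_bes (n : ℕ) (s : ℝ) :
    HasDerivAt (fun s => s ^ (n + 1) * bes (n + 1) s) (s ^ n * bes n s) s := by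
  convert! (hasDerivAt_pow (n + 1) s).mul (hasDerivAt_bes (n + 1) s) using 1
  have := bes_rec n s
  simp only [Nat.add_sub_cancel]
  push_cast
  rw [show bes n s = (n + 1) * bes (n + 1) s - (s / 4) * bes (n + 2) s by linarith]
  ring

lemma bes_zero_pos (n : ℕ) : 0 < bes n 0 := by
  rw [bes_zero]; positivity

/-- First zero of a continuous function that starts positive. -/
lemma exists_first_zero {f : ℝ → ℝ} (hf : Continuous f) (h0 : 0 < f 0) {b : ℝ} (hb : 0 ≤ b)
    (hfb : f b ≤ 0) : ∃ σ, 0 < σ ∧ f σ = 0 ∧ ∀ s ∈ Ico 0 σ, 0 < f s := by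
  set S := {s | s ∈ Icc 0 b ∧ f s ≤ 0} with hS
  have hc : IsClosed S := isClosed_Icc.inter (isClosed_le hf continuous_const)
  have hbd : BddBelow S := ⟨0, fun s hs => hs.1.1⟩
  have hne : S.Nonempty := ⟨b, ⟨hb, le_rfl⟩, hfb⟩
  have hm := hc.csInf_mem hne hbd
  have hpos : ∀ s ∈ Ico 0 (sInf S), 0 < f s := by
    intro s hs
    by_contra hcon
    exact absurd (csInf_le hbd (show s ∈ S from ⟨⟨hs.1, hs.2.le.trans hm.1.2⟩, not_lt.1 hcon⟩)) (not_le.2 hs.2)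
  have hσ : 0 < sInf S := by
    rcases hm.1.1.lt_or_eq with h | h
    · exact h
    · rw [← h] at hm; exact absurd hm.2 (not_le.2 h0)
  refine ⟨sInf S, hσ, le_antisymm hm.2 ?_, hpos⟩
  have : Filter.Tendsto f (nhdsWithin (sInf S) (Iio (sInf S))) (nhds (f (sInf S))) :=
    hf.continuousAt.tendsto.mono_left nhdsWithin_le_nhds
  refine ge_of_tendsto this ?_
  filter_upwards [Ioo_mem_nhdsLT hσ] with s hs
  exact (hpos s ⟨hs.1.le, hs.2⟩).le

lemma bes_succ_pos {n : ℕ} {σ : ℝ} (hp : ∀ s ∈ Ico 0 σ, 0 < bes n s) :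
    ∀ s ∈ Icc 0 σ, 0 < bes (n + 1) s := by
  intro s hs
  rcases hs.1.eq_or_lt with h | h
  · rw [← h]; exact bes_zero_pos _
  have hmono : StrictMonoOn (fun s => s ^ (n + 1) * bes (n + 1) s) (Icc 0 σ) := by
    refine strictMonoOn_of_deriv_pos (convex_Icc _ _)
      (fun s _ => (hasDerivAt_pow_mul_bes n s).continuousAt.continuousWithinAt) fun x hx => ?_
    rw [interior_Icc] at hx
    rw [(hasDerivAt_pow_mul_bes n x).deriv]
    exact mul_pos (pow_pos hx.1 _) (hp x ⟨hx.1.le, hx.2⟩)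
  have := hmono ⟨le_rfl, hs.1.trans hs.2⟩ hs h
  simp only [ne_eq, Nat.succ_ne_zero, not_false_eq_true, zero_pow, zero_mul] at this
  exact pos_of_mul_pos_right this (by positivity)

lemma exists_bes_zero_nonpos : ∃ b, 0 ≤ b ∧ bes 0 b ≤ 0 := by
  by_contra! hcon
  have hp1 : ∀ s, 0 ≤ s → 0 < bes 1 s := fun s hs =>
    bes_succ_pos (n := 0) (σ := s) (fun t ht => hcon t ht.1) s ⟨hs, le_rfl⟩
  set c := bes 1 1 with hc
  have hc0 : 0 < c := hp1 1 zero_le_one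
  have hmono : MonotoneOn (fun s => s ^ (0 + 1) * bes (0 + 1) s) (Ici 0) := by
    refine monotoneOn_of_deriv_nonneg (convex_Ici _)
      (fun s _ => (hasDerivAt_pow_mul_bes 0 s).continuousAt.continuousWithinAt)
      (fun s _ => (hasDerivAt_pow_mul_bes 0 s).differentiableAt.differentiableWithinAt) fun x hx => ?_
    rw [interior_Ici] at hx
    rw [(hasDerivAt_pow_mul_bes 0 x).deriv]
    exact mul_nonneg (pow_nonneg (le_of_lt hx) _) (hcon x (le_of_lt hx)).le
  have hd : ∀ x ∈ Ici (1 : ℝ), HasDerivAt (fun s => bes 0 s + c / 4 * Real.log s)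
      (-bes (0 + 1) x / 4 + c / 4 * x⁻¹) x := fun x hx =>
    (hasDerivAt_bes 0 x).add ((Real.hasDerivAt_log (by have : (1:ℝ) ≤ x := hx; positivity)).const_mul _)
  have hanti : AntitoneOn (fun s => bes 0 s + c / 4 * Real.log s) (Ici 1) := by
    refine antitoneOn_of_deriv_nonpos (convex_Ici _)
      (fun s hs => (hd s hs).continuousAt.continuousWithinAt)
      (fun s hs => (hd s (interior_subset hs)).differentiableAt.differentiableWithinAt) fun x hx => ?_
    have hx1 : (1 : ℝ) ≤ x := interior_subset hx
    rw [(hd x hx1).deriv]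
    have := hmono (show (0:ℝ) ≤ 1 by norm_num) (show (0:ℝ) ≤ x by linarith) hx1
    simp only [zero_add, pow_one, one_mul] at this
    have h2 : c * x⁻¹ ≤ bes 1 x := by
      rw [← div_eq_mul_inv, div_le_iff₀ (by linarith)]; linarith
    simp only [zero_add]
    linarith
  have hx : (1:ℝ) ≤ Real.exp (4 * (bes 0 1) / c) := by
    have := (hcon 1 zero_le_one).le
    exact Real.one_le_exp (div_nonneg (by linarith) hc0.le)
  have := hanti (show (1:ℝ) ≤ 1 from le_rfl) hx hx
  simp only [Real.log_exp, Real.log_one] at this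
  have h3 := hcon _ (by positivity : 0 ≤ Real.exp (4 * (bes 0 1) / c))
  have h4 : c / 4 * (4 * bes 0 1 / c) = bes 0 1 := by field_simp
  linarith

lemma exists_bes_succ_nonpos {n : ℕ} {σ : ℝ} (hσ : 0 < σ) (h0 : bes n σ = 0) :
    ∃ b, 0 ≤ b ∧ bes (n + 1) b ≤ 0 := by
  by_contra! hcon
  have hanti : StrictAntiOn (bes n) (Ici 0) := by
    refine strictAntiOn_of_deriv_neg (convex_Ici _) (continuous_bes n).continuousOn fun x hx => ?_
    rw [interior_Ici] at hx
    rw [(hasDerivAt_bes n x).deriv]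
    have := hcon x (le_of_lt hx)
    linarith
  set c := -bes n (σ + 1) with hc
  have hc0 : 0 < c := by
    have := hanti hσ.le (show (0:ℝ) ≤ σ + 1 by linarith) (by linarith)
    linarith
  have hd := fun x => (hasDerivAt_pow_mul_bes n x).add ((hasDerivAt_id x).const_mul c)
  have hanti2 : AntitoneOn (fun s => s ^ (n + 1) * bes (n + 1) s + c * s) (Ici (σ + 1)) := by
    refine antitoneOn_of_deriv_nonpos (convex_Ici _)
      (fun s hs => (hd s).continuousAt.continuousWithinAt)
      (fun s hs => (hd s).differentiableAt.differentiableWithinAt) fun x hx => ?_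
    have hx1 : σ + 1 ≤ x := interior_subset hx
    refine (hd x).deriv.trans_le ?_
    have h1 := hanti.antitoneOn (show (0:ℝ) ≤ σ + 1 by linarith) (show (0:ℝ) ≤ x by linarith) hx1
    have h2 : (1:ℝ) ≤ x ^ n := one_le_pow₀ (by linarith)
    nlinarith
  set P := (σ + 1) ^ (n + 1) * bes (n + 1) (σ + 1) with hP
  have hP0 : 0 < P := mul_pos (by positivity) (hcon _ (by linarith))
  have hle : σ + 1 ≤ σ + 1 + P / c := by have := div_pos hP0 hc0; linarith
  have := hanti2 (show σ + 1 ≤ σ + 1 from le_rfl) hle hle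
  have h5 : 0 < (σ + 1 + P / c) ^ (n + 1) * bes (n + 1) (σ + 1 + P / c) :=
    mul_pos (by positivity) (hcon _ (by positivity))
  have h6 : c * (P / c) = P := by field_simp
  simp only at this
  nlinarith

/-- Interlacing of the first zeros of the first three Bessel functions, with the signs needed. -/
lemma exists_bes_zeros : ∃ s0 s1 s2 ν : ℝ, 0 < s0 ∧ s0 < s1 ∧ s1 < s2 ∧ s2 < ν ∧
    bes 0 s0 = 0 ∧ bes 1 s1 = 0 ∧ bes 2 s2 = 0 ∧
    (∀ s ∈ Icc 0 ν, bes 0 s = 0 → s = s0) ∧ (∀ s ∈ Icc 0 ν, bes 1 s = 0 → s = s1) ∧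
    (∀ s ∈ Icc 0 ν, bes 2 s = 0 → s = s2) ∧ (∀ s ∈ Icc 0 ν, bes 3 s ≠ 0) := by
  obtain ⟨b, hb, hfb⟩ := exists_bes_zero_nonpos
  obtain ⟨s0, hs0, hz0, hp0⟩ := exists_first_zero (continuous_bes 0) (bes_zero_pos 0) hb hfb
  obtain ⟨b, hb, hfb⟩ := exists_bes_succ_nonpos hs0 hz0
  obtain ⟨s1, hs1, hz1, hp1⟩ := exists_first_zero (continuous_bes 1) (bes_zero_pos 1) hb hfb
  obtain ⟨b, hb, hfb⟩ := exists_bes_succ_nonpos hs1 hz1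
  obtain ⟨s2, hs2, hz2, hp2⟩ := exists_first_zero (continuous_bes 2) (bes_zero_pos 2) hb hfb
  have lt_aux : ∀ {n : ℕ} {σ τ : ℝ}, 0 < τ → (∀ s ∈ Ico 0 σ, 0 < bes n s) → bes (n + 1) τ = 0 →
      σ < τ := by
    intro n σ τ hτ hp hz
    by_contra hcon
    have := bes_succ_pos hp τ ⟨hτ.le, not_lt.1 hcon⟩
    linarith
  have h01 : s0 < s1 := lt_aux hs1 hp0 hz1
  have h12 : s1 < s2 := lt_aux hs2 hp1 hz2
  have hp3 := bes_succ_pos hp2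
  -- strict decrease
  have anti : ∀ {n : ℕ} {σ : ℝ}, (∀ s ∈ Ico 0 σ, 0 < bes (n + 1) s) → StrictAntiOn (bes n) (Icc 0 σ) := by
    intro n σ hp
    refine strictAntiOn_of_deriv_neg (convex_Icc _ _) (continuous_bes n).continuousOn fun x hx => ?_
    rw [interior_Icc] at hx
    rw [(hasDerivAt_bes n x).deriv]
    have := hp x ⟨hx.1.le, hx.2⟩
    linarith
  have hn1 : ∀ s ∈ Ioc s1 s2, bes 1 s < 0 := by
    intro s hs
    rw [← hz1]
    exact anti hp2 ⟨hs1.le, h12.le⟩ ⟨hs1.le.trans hs.1.le, hs.2⟩ hs.1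
  have hn0 : ∀ s ∈ Ioc s0 s2, bes 0 s < 0 := by
    intro s hs
    rcases le_or_gt s s1 with h | h
    · rw [← hz0]
      exact anti hp1 ⟨hs0.le, h01.le⟩ ⟨hs0.le.trans hs.1.le, h⟩ hs.1
    · have e := bes_rec 0 s
      have h1 := hn1 s ⟨h, hs.2⟩
      have h2 : 0 ≤ bes 2 s := by
        rcases hs.2.lt_or_eq with h' | h'
        · exact (hp2 s ⟨by linarith, h'⟩).le
        · rw [h', hz2]
      norm_num at e
      have : 0 ≤ s / 4 * bes 2 s := mul_nonneg (by linarith) h2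
      linarith
  obtain ⟨δ, hδ, hδ'⟩ : ∃ δ > 0, ∀ s, |s - s2| < δ → bes 0 s < 0 ∧ bes 1 s < 0 ∧ 0 < bes 3 s := by
    have e0 := (continuous_bes 0).continuousAt.eventually_lt (x₀ := s2) continuousAt_const (hn0 s2 ⟨h01.trans h12, le_rfl⟩)
    have e1 := (continuous_bes 1).continuousAt.eventually_lt (x₀ := s2) continuousAt_const (hn1 s2 ⟨h12, le_rfl⟩)
    have e3 := continuousAt_const.eventually_lt (continuous_bes 3).continuousAt (x₀ := s2) (hp3 s2 ⟨hs2.le, le_rfl⟩)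
    obtain ⟨δ, hδ, h⟩ := Metric.eventually_nhds_iff.1 (e0.and (e1.and e3))
    exact ⟨δ, hδ, fun s hs => h (by rwa [Real.dist_eq])⟩
  have near : ∀ s, s2 ≤ s → s ≤ s2 + δ / 2 → |s - s2| < δ := fun s h h' => by
    rw [abs_of_nonneg (by linarith)]; linarith
  have hp3' : ∀ s ∈ Icc 0 (s2 + δ / 2), 0 < bes 3 s := by
    intro s hs
    rcases le_or_gt s s2 with h | h
    · exact hp3 s ⟨hs.1, h⟩
    · exact (hδ' s (near s h.le hs.2)).2.2
  refine ⟨s0, s1, s2, s2 + δ / 2, hs0, h01, h12, by linarith, hz0, hz1, hz2, ?_, ?_, ?_, fun s hs => (hp3' s hs).ne'⟩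
  · intro s hs hz
    rcases lt_trichotomy s s0 with h | h | h
    · exact absurd hz (hp0 s ⟨hs.1, h⟩).ne'
    · exact h
    · rcases le_or_gt s s2 with h' | h'
      · exact absurd hz (hn0 s ⟨h, h'⟩).ne
      · exact absurd hz (hδ' s (near s h'.le hs.2)).1.ne
  · intro s hs hz
    rcases lt_trichotomy s s1 with h | h | h
    · exact absurd hz (hp1 s ⟨hs.1, h⟩).ne'
    · exact h
    · rcases le_or_gt s s2 with h' | h'
      · exact absurd hz (hn1 s ⟨h, h'⟩).ne
      · exact absurd hz (hδ' s (near s h'.le hs.2)).2.1.ne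
  · intro s hs hz
    have := (anti (fun s hs => hp3' s ⟨hs.1, hs.2.le⟩)).injOn hs ⟨hs2.le, by linarith⟩ (hz.trans hz2.symm)
    exact this

/-- The logarithmic derivative, times `r`, of the radial profile `ψ(r) = r^n f_n(ν r²)`. -/
def logDer (n : ℕ) (ν r : ℝ) : ℝ :=
  n - ν * r ^ 2 / 2 * (bes (n + 1) (ν * r ^ 2) / bes n (ν * r ^ 2))

lemma hasDerivAt_bes_comp (n : ℕ) (ν r : ℝ) :
    HasDerivAt (fun r => bes n (ν * r ^ 2)) (-bes (n + 1) (ν * r ^ 2) / 4 * (ν * (2 * r))) r := by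
  have h : HasDerivAt (fun r : ℝ => ν * r ^ 2) (ν * (2 * r)) r := by
    simpa using (hasDerivAt_pow 2 r).const_mul ν
  exact (hasDerivAt_bes n _).comp r h

lemma continuous_bes_comp (n : ℕ) (ν : ℝ) : Continuous fun r => bes n (ν * r ^ 2) :=
  (continuous_bes n).comp (by fun_prop)

lemma hasDerivAt_logDer {n : ℕ} {ν r : ℝ} (hr : r ≠ 0) (hz : bes n (ν * r ^ 2) ≠ 0) :
    HasDerivAt (logDer n ν) ((n ^ 2 - ν * r ^ 2 - logDer n ν r ^ 2) / r) r := by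
  have h : HasDerivAt (fun r : ℝ => ν * r ^ 2 / 2) (ν * (2 * r) / 2) r := by
    simpa using ((hasDerivAt_pow 2 r).const_mul ν).div_const 2
  have := (h.mul ((hasDerivAt_bes_comp (n + 1) ν r).div (hasDerivAt_bes_comp n ν r) hz)).const_sub (n : ℝ)
  convert! this using 1
  have e := bes_rec n (ν * r ^ 2)
  simp only [logDer, Pi.div_apply]
  set F := bes n (ν * r ^ 2)
  set G := bes (n + 1) (ν * r ^ 2)
  rw [show n + 1 + 1 = n + 2 from rfl]
  set K := bes (n + 2) (ν * r ^ 2)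
  field_simp
  linear_combination (-(16 * ν * r ^ 2 * F) : ℝ) * e

lemma continuousAt_logDer {n : ℕ} {ν r : ℝ} (hz : bes n (ν * r ^ 2) ≠ 0) :
    ContinuousAt (logDer n ν) r := by
  unfold logDer
  exact continuousAt_const.sub ((by fun_prop : Continuous fun r : ℝ => ν * r ^ 2 / 2).continuousAt.mul
    ((continuous_bes_comp (n + 1) ν).continuousAt.div (continuous_bes_comp n ν).continuousAt hz))

/-- Picone-type inequality on an interval where the comparison profile has no interior zero. -/
lemma picone_interval {n : ℕ} {ν a b : ℝ} {A B C : ℝ → ℝ} (ha : 0 < a) (hab : a ≤ b)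
    (hA : ∀ r, HasDerivAt A (2 * B r) r) (hC : Continuous C)
    (hq : ∀ r t, 0 ≤ C r - 2 * t * B r + t ^ 2 * A r)
    (hz : ∀ r ∈ Ioo a b, bes n (ν * r ^ 2) ≠ 0)
    (hG : ContinuousOn (fun r => A r * logDer n ν r) (Icc a b)) :
    A b * logDer n ν b - A a * logDer n ν a ≤
      ∫ r in a..b, r * (C r + n ^ 2 / r ^ 2 * A r - ν * A r) := by
  have hAc : Continuous A := continuous_iff_continuousAt.2 fun r => (hA r).continuousAt
  refine intervalIntegral.sub_le_integral_of_hasDeriv_right_of_le hab hG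
    (g' := fun r => 2 * B r * logDer n ν r + A r * ((n ^ 2 - ν * r ^ 2 - logDer n ν r ^ 2) / r))
    (fun r hr => ((hA r).mul (hasDerivAt_logDer (ha.trans hr.1).ne' (hz r hr))).hasDerivWithinAt) ?_ ?_
  · refine ContinuousOn.integrableOn_Icc ?_
    have : ContinuousOn (fun r : ℝ => (n : ℝ) ^ 2 / r ^ 2) (Icc a b) :=
      continuousOn_const.div (by fun_prop) fun r hr => by
        have : 0 < r := ha.trans_le hr.1
        positivity
    exact continuousOn_id.mul ((hC.continuousOn.add (this.mul hAc.continuousOn)).sub (by fun_prop))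
  · intro r hr
    have hr0 : 0 < r := ha.trans hr.1
    have := mul_nonneg hr0.le (hq r (logDer n ν r / r))
    have e : r * (C r + n ^ 2 / r ^ 2 * A r - ν * A r) - (2 * B r * logDer n ν r +
      A r * ((n ^ 2 - ν * r ^ 2 - logDer n ν r ^ 2) / r)) =
      r * (C r - 2 * (logDer n ν r / r) * B r + (logDer n ν r / r) ^ 2 * A r) := by
      field_simp
      ring
    linarith

/-- At a simple zero of the comparison profile where `A` vanishes to second order,
`A * logDer` is continuous. -/
lemma continuousAt_mul_logDer_zero {n : ℕ} {ν ρ : ℝ} {A : ℝ → ℝ} (hρ : 0 < ρ) (hν : 0 < ν)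
    (hA : HasDerivAt A 0 ρ) (hA0 : A ρ = 0) (hz : bes n (ν * ρ ^ 2) = 0)
    (hz' : bes (n + 1) (ν * ρ ^ 2) ≠ 0) : ContinuousAt (fun r => A r * logDer n ν r) ρ := by
  have h1 := hasDerivAt_iff_tendsto_slope.1 hA
  have h2 := hasDerivAt_iff_tendsto_slope.1 (hasDerivAt_bes_comp n ν ρ)
  have hne : -bes (n + 1) (ν * ρ ^ 2) / 4 * (ν * (2 * ρ)) ≠ 0 :=
    mul_ne_zero (div_ne_zero (neg_ne_zero.2 hz') (by norm_num)) (by positivity)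
  have h3 := h1.div h2 hne
  have h4 : Filter.Tendsto (fun r => A r / bes n (ν * r ^ 2)) (nhdsWithin ρ {ρ}ᶜ) (nhds 0) := by
    rw [zero_div] at h3
    refine h3.congr' ?_
    filter_upwards [self_mem_nhdsWithin] with r hr
    have : r - ρ ≠ 0 := sub_ne_zero.2 hr
    simp only [slope_def_field, hA0, hz, sub_zero, Pi.div_apply]
    field_simp
  have h5 : Filter.Tendsto (fun r => A r * n - ν * r ^ 2 / 2 * bes (n + 1) (ν * r ^ 2) *
      (A r / bes n (ν * r ^ 2))) (nhdsWithin ρ {ρ}ᶜ) (nhds (A ρ * n - ν * ρ ^ 2 / 2 * bes (n + 1) (ν * ρ ^ 2) * 0)) := by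
    refine Filter.Tendsto.sub ?_ (Filter.Tendsto.mul ?_ h4)
    · exact (hA.continuousAt.tendsto.mul_const _).mono_left nhdsWithin_le_nhds
    · have : Continuous fun r => ν * r ^ 2 / 2 * bes (n + 1) (ν * r ^ 2) :=
        (by fun_prop : Continuous fun r : ℝ => ν * r ^ 2 / 2).mul (continuous_bes_comp (n + 1) ν)
      exact (this.tendsto ρ).mono_left nhdsWithin_le_nhds
  rw [continuousAt_iff_punctured_nhds]
  simp only [hA0, zero_mul, mul_zero, sub_zero] at h5 ⊢
  refine h5.congr fun r => ?_
  simp only [logDer]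
  ring

lemma picone_mode {n : ℕ} {ν ε b ρ : ℝ} {A B C : ℝ → ℝ} (hν : 0 < ν) (hε : 0 < ε) (hab : ε ≤ b)
    (hA : ∀ r, HasDerivAt A (2 * B r) r) (hC : Continuous C)
    (hq : ∀ r t, 0 ≤ C r - 2 * t * B r + t ^ 2 * A r) (hAb : A b = 0)
    (hz : ∀ r ∈ Ioc 0 b, bes n (ν * r ^ 2) = 0 → r = ρ ∧ A r = 0 ∧ bes (n + 1) (ν * r ^ 2) ≠ 0) :
    - (A ε * logDer n ν ε) ≤ ∫ r in ε..b, r * (C r + n ^ 2 / r ^ 2 * A r - ν * A r) := by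
  have hG : ∀ r ∈ Ioc 0 b, ContinuousAt (fun r => A r * logDer n ν r) r := by
    intro r hr
    by_cases h : bes n (ν * r ^ 2) = 0
    · obtain ⟨-, h0, h1⟩ := hz r hr h
      have hB : B r = 0 := by
        by_contra hB
        have := hq r ((C r + 1) / (2 * B r))
        rw [h0] at this
        have e : 2 * ((C r + 1) / (2 * B r)) * B r = C r + 1 := by field_simp
        rw [e] at this
        linarith
      refine continuousAt_mul_logDer_zero hr.1 hν ?_ h0 h h1
      have := hA r
      rwa [hB, mul_zero] at this
    · exact (hA r).continuousAt.mul (continuousAt_logDer h)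
  have hGo : ∀ {a' b'}, 0 < a' → b' ≤ b → ContinuousOn (fun r => A r * logDer n ν r) (Icc a' b') :=
    fun ha' hb' r hr => (hG r ⟨ha'.trans_le hr.1, hr.2.trans hb'⟩).continuousWithinAt
  have hAc : Continuous A := continuous_iff_continuousAt.2 fun r => (hA r).continuousAt
  by_cases h : ρ ∈ Ioo ε b ∧ bes n (ν * ρ ^ 2) = 0
  · obtain ⟨hρ, h⟩ := h
    have h1 := picone_interval (n := n) (ν := ν) hε hρ.1.le hA hC hq (fun r hr hr0 =>
      hr.2.ne (hz r ⟨hε.trans hr.1, hr.2.le.trans hρ.2.le⟩ hr0).1) (hGo hε hρ.2.le)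
    have h2 := picone_interval (n := n) (ν := ν) (hε.trans hρ.1) hρ.2.le hA hC hq (fun r hr hr0 =>
      hr.1.ne' (hz r ⟨(hε.trans hρ.1).trans hr.1, hr.2.le⟩ hr0).1) (hGo (hε.trans hρ.1) le_rfl)
    have hi : ∀ {a' b'}, 0 < a' → a' ≤ b' → IntervalIntegrable
        (fun r => r * (C r + n ^ 2 / r ^ 2 * A r - ν * A r)) volume a' b' := by
      intro a' b' ha' hab'
      refine ContinuousOn.intervalIntegrable_of_Icc hab' ?_
      have : ContinuousOn (fun r : ℝ => (n : ℝ) ^ 2 / r ^ 2) (Icc a' b') :=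
        continuousOn_const.div (by fun_prop) fun r hr => by
          have : 0 < r := ha'.trans_le hr.1
          positivity
      exact continuousOn_id.mul ((hC.continuousOn.add (this.mul hAc.continuousOn)).sub (by fun_prop))
    rw [← intervalIntegral.integral_add_adjacent_intervals (hi hε hρ.1.le) (hi (hε.trans hρ.1) hρ.2.le)]
    rw [hAb] at h2
    linarith
  · have h1 := picone_interval (n := n) (ν := ν) hε hab hA hC hq (fun r hr hr0 => by
      have := (hz r ⟨hε.trans hr.1, hr.2.le⟩ hr0).1
      subst this
      exact h ⟨hr, hr0⟩) (hGo hε le_rfl)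
    rw [hAb] at h1
    linarith

/-- The first five trigonometric functions. -/
def trig (j : Fin 5) (θ : ℝ) : ℝ :=
  ![1, Real.cos θ, Real.sin θ, Real.cos (2 * θ), Real.sin (2 * θ)] j

/-- The frequency of `trig j`. -/
def tdeg (j : Fin 5) : ℕ := ![0, 1, 1, 2, 2] j

/-- The squared norm of `trig j` on a period. -/
def tnorm (j : Fin 5) : ℝ := ![2 * π, π, π, π, π] j

lemma tnorm_pos (j : Fin 5) : 0 < tnorm j := by
  fin_cases j <;> simp [tnorm, Real.pi_pos]

lemma continuous_trig (j : Fin 5) : Continuous (trig j) := by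
  unfold trig
  fin_cases j <;> simp <;> fun_prop

/-- Unnormalised trigonometric coefficient. -/
def tcoef (j : Fin 5) (f : ℝ → ℝ) : ℝ := ∫ θ in (-π)..π, f θ * trig j θ

lemma neg_pi_lt_pi : -π < π := by linarith [Real.pi_pos]

lemma fourierCoeffOn_sq {f : ℝ → ℝ} (hf : Continuous f) (n : ℤ) :
    ‖fourierCoeffOn neg_pi_lt_pi (fun x => (f x : ℂ)) n‖ ^ 2 = (1 / (2 * π)) ^ 2 *
      ((∫ θ in (-π)..π, f θ * Real.cos (n * θ)) ^ 2 + (∫ θ in (-π)..π, f θ * Real.sin (n * θ)) ^ 2) := by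
  have hpi := Real.pi_ne_zero
  have e : ∀ x : ℝ, fourier (-n) (x : AddCircle (π - -π)) • (f x : ℂ) =
      ((f x * Real.cos (n * x) : ℝ) : ℂ) - ((f x * Real.sin (n * x) : ℝ) : ℂ) * Complex.I := by
    intro x
    rw [fourier_coe_apply]
    have : 2 * (π : ℂ) * Complex.I * ((-n : ℤ) : ℂ) * (x : ℂ) / ((π - -π : ℝ) : ℂ) = (-(n * x : ℝ) : ℂ) * Complex.I := by
      push_cast
      have : (π : ℂ) ≠ 0 := by exact_mod_cast hpi
      field_simp
      ring
    rw [this, Complex.exp_mul_I, ← Complex.ofReal_neg, ← Complex.ofReal_cos, ← Complex.ofReal_sin, Real.cos_neg, Real.sin_neg]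
    simp only [smul_eq_mul]
    push_cast
    ring
  rw [fourierCoeffOn_eq_integral]
  simp_rw [e]
  rw [intervalIntegral.integral_sub, intervalIntegral.integral_mul_const, intervalIntegral.integral_ofReal,
    intervalIntegral.integral_ofReal]
  · rw [norm_smul, mul_pow, ← Complex.normSq_eq_norm_sq, Complex.normSq_apply]
    simp only [Complex.sub_re, Complex.ofReal_re, Complex.re_ofReal_mul, Complex.I_re, Complex.sub_im, Complex.ofReal_im,
      Complex.im_ofReal_mul, Complex.I_im]
    rw [show π - -π = 2 * π by ring, Real.norm_eq_abs, sq_abs]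
    ring
  · exact Continuous.intervalIntegrable (by fun_prop) _ _
  · exact Continuous.intervalIntegrable (by fun_prop) _ _

lemma hasSum_fourierCoeffOn {f : ℝ → ℝ} (hf : Continuous f) :
    HasSum (fun n : ℤ => ‖fourierCoeffOn neg_pi_lt_pi (fun x => (f x : ℂ)) n‖ ^ 2)
      ((1 / (2 * π)) * ∫ θ in (-π)..π, f θ ^ 2) := by
  have hm : MemLp (fun x => (f x : ℂ)) 2 (volume.restrict (Ioc (-π) π)) := by
    have hc : ContinuousOn (fun x => (f x : ℂ)) (Icc (-π) π) := (Complex.continuous_ofReal.comp hf).continuousOn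
    obtain ⟨M, hM⟩ := isCompact_Icc.exists_bound_of_continuousOn hc
    refine MemLp.of_bound (Complex.continuous_ofReal.comp hf).aestronglyMeasurable M ?_
    filter_upwards [ae_restrict_mem measurableSet_Ioc] with x hx
    exact hM x ⟨hx.1.le, hx.2⟩
  have := hasSum_sq_fourierCoeffOn neg_pi_lt_pi hm
  simpa [show π - -π = 2 * π by ring] using this

lemma fourierCoeffOn_deriv_sq {f f' : ℝ → ℝ} (hf : ∀ θ, HasDerivAt f (f' θ) θ) (hf' : Continuous f')
    (hper : f π = f (-π)) (n : ℤ) :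
    ‖fourierCoeffOn neg_pi_lt_pi (fun x => (f' x : ℂ)) n‖ ^ 2 =
      n ^ 2 * ‖fourierCoeffOn neg_pi_lt_pi (fun x => (f x : ℂ)) n‖ ^ 2 := by
  have hi : IntervalIntegrable (fun x => (f' x : ℂ)) volume (-π) π :=
    (Complex.continuous_ofReal.comp hf').intervalIntegrable _ _
  by_cases hn : n = 0
  · subst hn
    rw [fourierCoeffOn_sq hf']
    simp only [Int.cast_zero, zero_mul, Real.cos_zero, Real.sin_zero, mul_one, mul_zero,
      intervalIntegral.integral_zero]
    rw [intervalIntegral.integral_eq_sub_of_hasDerivAt (fun x _ => hf x) (hf'.intervalIntegrable _ _), hper]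
    simp
  · have h := fourierCoeffOn_of_hasDerivAt neg_pi_lt_pi hn (f := fun x => (f x : ℂ)) (f' := fun x => (f' x : ℂ))
      (fun x _ => (hf x).ofReal_comp) hi
    rw [hper, sub_self, mul_zero, zero_sub] at h
    have hn' : (n : ℝ) ≠ 0 := by exact_mod_cast hn
    have hpi := Real.pi_ne_zero
    rw [h]
    simp only [norm_mul, norm_neg, norm_div, norm_one, Complex.norm_I, Complex.norm_intCast, Complex.norm_real,
      Complex.norm_ofNat, Real.norm_eq_abs]
    rw [show ((π : ℂ) - ((-π : ℝ) : ℂ)) = ((2 * π : ℝ) : ℂ) by push_cast; ring, Complex.norm_real, Real.norm_eq_abs,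
      abs_of_pos (by positivity : 0 < 2 * π), abs_of_pos Real.pi_pos]
    have h2 : |(n : ℝ)| ≠ 0 := abs_ne_zero.2 hn'
    rw [← sq_abs (n : ℝ)]
    field_simp

lemma sum_fourierCoeffOn_eq {f : ℝ → ℝ} (hf : Continuous f) (w : ℕ → ℝ) :
    ∑ n ∈ Finset.Icc (-2 : ℤ) 2, w n.natAbs * ‖fourierCoeffOn neg_pi_lt_pi (fun x => (f x : ℂ)) n‖ ^ 2 =
      1 / (2 * π) * ∑ j, w (tdeg j) * (tcoef j f ^ 2 / tnorm j) := by
  have hs : Finset.Icc (-2 : ℤ) 2 = {-2, -1, 0, 1, 2} := by decide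
  rw [hs]
  have hpi := Real.pi_ne_zero
  simp only [fourierCoeffOn_sq hf]
  simp [Fin.sum_univ_five, tdeg, tcoef, tnorm, trig, intervalIntegral.integral_neg]
  field_simp
  ring

lemma trig_bessel {f : ℝ → ℝ} (hf : Continuous f) :
    ∑ j, tcoef j f ^ 2 / tnorm j ≤ ∫ θ in (-π)..π, f θ ^ 2 := by
  have h := sum_le_hasSum (Finset.Icc (-2 : ℤ) 2) (fun n _ => sq_nonneg _) (hasSum_fourierCoeffOn hf)
  have e := sum_fourierCoeffOn_eq hf (fun _ => 1)
  simp only [one_mul] at e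
  rw [e] at h
  exact le_of_mul_le_mul_left h (by have := Real.pi_pos; positivity)

lemma trig_wirtinger {f f' : ℝ → ℝ} (hf : ∀ θ, HasDerivAt f (f' θ) θ) (hf' : Continuous f')
    (hper : f π = f (-π)) :
    9 * ((∫ θ in (-π)..π, f θ ^ 2) - ∑ j, tcoef j f ^ 2 / tnorm j) ≤
      (∫ θ in (-π)..π, f' θ ^ 2) - ∑ j, (tdeg j : ℝ) ^ 2 * (tcoef j f ^ 2 / tnorm j) := by
  have hfc : Continuous f := continuous_iff_continuousAt.2 fun θ => (hf θ).continuousAt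
  have h1 := hasSum_fourierCoeffOn hf'
  simp only [fourierCoeffOn_deriv_sq hf hf' hper] at h1
  have h2 := h1.sub ((hasSum_fourierCoeffOn hfc).mul_left 9)
  have h := sum_le_hasSum (Finset.Icc (-2 : ℤ) 2) (fun n hn => ?_) h2
  · have e := sum_fourierCoeffOn_eq hfc (fun n => (n : ℝ) ^ 2 - 9)
    have e' : ∑ n ∈ Finset.Icc (-2 : ℤ) 2, ((n : ℝ) ^ 2 * ‖fourierCoeffOn neg_pi_lt_pi (fun x => (f x : ℂ)) n‖ ^ 2 -
      9 * ‖fourierCoeffOn neg_pi_lt_pi (fun x => (f x : ℂ)) n‖ ^ 2) =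
      1 / (2 * π) * ∑ j, ((tdeg j : ℝ) ^ 2 - 9) * (tcoef j f ^ 2 / tnorm j) := by
      rw [← e]
      refine Finset.sum_congr rfl fun n _ => ?_
      rw [show (n : ℝ) ^ 2 = (n.natAbs : ℝ) ^ 2 by rw [Nat.cast_natAbs, Int.cast_abs, sq_abs]]
      ring
    rw [e', show ∀ a b : ℝ, 1 / (2 * π) * a - 9 * (1 / (2 * π) * b) = 1 / (2 * π) * (a - 9 * b) by intros; ring] at h
    have h3 := le_of_mul_le_mul_left h (by have := Real.pi_pos; positivity)
    simp only [sub_mul, Finset.sum_sub_distrib, ← Finset.mul_sum] at h3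
    linarith
  · rw [← sub_mul]
    refine mul_nonneg ?_ (sq_nonneg _)
    have : 3 ≤ |n| := by
      by_contra hcon
      exact hn (by rw [Finset.mem_Icc]; have := abs_lt.1 (not_le.1 hcon); omega)
    have h3 : (3 : ℝ) ≤ |(n : ℝ)| := by exact_mod_cast this
    rw [← sq_abs]
    nlinarith

/-- The point with polar coordinates `(r, θ)`. -/
def pol (r θ : ℝ) : ℝ × ℝ := (r * Real.cos θ, r * Real.sin θ)

lemma pol_sq (r θ : ℝ) : (pol r θ).1 ^ 2 + (pol r θ).2 ^ 2 = r ^ 2 := by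
  simp only [pol]
  linear_combination r ^ 2 * Real.sin_sq_add_cos_sq θ

lemma continuous_pol : Continuous (fun p : ℝ × ℝ => pol p.1 p.2) := by
  unfold pol; fun_prop

lemma integral_polar {F : ℝ × ℝ → ℝ} (hF : Continuous F) {b : ℝ} (hb : 0 < b)
    (h0 : ∀ p, p ∉ disk b → F p = 0) :
    ∫ p, F p = ∫ r in (0)..b, r * ∫ θ in (-π)..π, F (pol r θ) := by
  rw [← integral_comp_polarCoord_symm]
  have hG : Continuous fun p : ℝ × ℝ => p.1 * F (pol p.1 p.2) :=
    continuous_fst.mul (hF.comp continuous_pol)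
  have e : ∫ p in polarCoord.target, p.1 • F (polarCoord.symm p) =
      ∫ p in Ioc 0 b ×ˢ Ioo (-π) π, p.1 * F (pol p.1 p.2) := by
    refine setIntegral_eq_of_subset_of_forall_sdiff_eq_zero ?_ ?_ ?_
    · exact measurableSet_Ioi.prod measurableSet_Ioo
    · exact prod_mono Ioc_subset_Ioi_self subset_rfl
    · rintro ⟨r, θ⟩ ⟨⟨h1, h2⟩, h3⟩
      simp only [mem_prod, mem_Ioc, not_and] at h1 h2 h3
      have hr : b < r := by
        by_contra hcon
        exact h3 ⟨h1, not_lt.1 hcon⟩ h2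
      rw [show polarCoord.symm (r, θ) = pol r θ from rfl, h0, smul_zero]
      change ¬ ((pol _ θ).1 ^ 2 + (pol _ θ).2 ^ 2 < b ^ 2)
      rw [pol_sq]
      nlinarith
  rw [e, Measure.volume_eq_prod, setIntegral_prod]
  · rw [intervalIntegral.integral_of_le hb.le]
    refine setIntegral_congr_fun measurableSet_Ioc fun r _ => ?_
    simp only
    rw [intervalIntegral.integral_of_le neg_pi_lt_pi.le, integral_Ioc_eq_integral_Ioo,
      integral_const_mul]
  · rw [← Measure.volume_eq_prod]
    exact (hG.continuousOn.integrableOn_compact (isCompact_Icc.prod isCompact_Icc)).mono_set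
      (prod_mono Ioc_subset_Icc_self Ioo_subset_Icc_self)

lemma hasDerivAt_param_integral {K K' : ℝ → ℝ → ℝ} (hK : Continuous (Function.uncurry K))
    (hK' : Continuous (Function.uncurry K')) (hd : ∀ r θ, HasDerivAt (fun r => K r θ) (K' r θ) r)
    (a b r : ℝ) : HasDerivAt (fun r => ∫ θ in a..b, K r θ) (∫ θ in a..b, K' r θ) r := by
  obtain ⟨M, hM⟩ := (isCompact_Icc (a := r - 1) (b := r + 1)).prod (isCompact_uIcc (a := a) (b := b))
    |>.exists_bound_of_continuousOn hK'.continuousOn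
  refine (intervalIntegral.hasDerivAt_integral_of_dominated_loc_of_deriv_le
    (s := Icc (r - 1) (r + 1)) (bound := fun _ => M) (Icc_mem_nhds (by linarith) (by linarith))
    (.of_forall fun x => ?_) ?_ ?_ ?_ ?_ ?_).2
  · exact (hK.comp (by fun_prop : Continuous fun θ : ℝ => (x, θ))).aestronglyMeasurable
  · exact (hK.comp (by fun_prop : Continuous fun θ : ℝ => (r, θ))).intervalIntegrable _ _
  · exact (hK'.comp (by fun_prop : Continuous fun θ : ℝ => (r, θ))).aestronglyMeasurable
  · exact .of_forall fun θ hθ x hx => hM (x, θ) ⟨hx, uIoc_subset_uIcc hθ⟩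
  · exact intervalIntegrable_const
  · exact .of_forall fun θ _ x _ => hd x θ

section polarDerivatives

variable {u : ℝ × ℝ → ℝ}

/-- Radial derivative. -/
def radD (u : ℝ × ℝ → ℝ) (r θ : ℝ) : ℝ := fderiv ℝ u (pol r θ) (Real.cos θ, Real.sin θ)

/-- Unit tangential derivative. -/
def tanD (u : ℝ × ℝ → ℝ) (r θ : ℝ) : ℝ := fderiv ℝ u (pol r θ) (-Real.sin θ, Real.cos θ)

lemma gradSq_pol (u : ℝ × ℝ → ℝ) (r θ : ℝ) :
    gradSq u (pol r θ) = radD u r θ ^ 2 + tanD u r θ ^ 2 := by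
  have e : ∀ a b : ℝ, fderiv ℝ u (pol r θ) (a, b) =
      a * fderiv ℝ u (pol r θ) (1, 0) + b * fderiv ℝ u (pol r θ) (0, 1) := by
    intro a b
    rw [show ((a, b) : ℝ × ℝ) = a • ((1 : ℝ), (0 : ℝ)) + b • ((0 : ℝ), (1 : ℝ)) by simp, map_add,
      map_smul, map_smul]
    rfl
  rw [gradSq, radD, tanD, e (Real.cos θ), e (-Real.sin θ)]
  set X := fderiv ℝ u (pol r θ) (1, 0)
  set Y := fderiv ℝ u (pol r θ) (0, 1)
  linear_combination (-(X ^ 2 + Y ^ 2)) * Real.sin_sq_add_cos_sq θ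

lemma hasDerivAt_rad (hu : Differentiable ℝ u) (r θ : ℝ) :
    HasDerivAt (fun r => u (pol r θ)) (radD u r θ) r := by
  have h : HasDerivAt (fun r => pol r θ) (Real.cos θ, Real.sin θ) r := by
    simpa [pol] using ((hasDerivAt_id r).mul_const (Real.cos θ)).prodMk ((hasDerivAt_id r).mul_const (Real.sin θ))
  exact (hu _).hasFDerivAt.comp_hasDerivAt r h

lemma hasDerivAt_ang (hu : Differentiable ℝ u) (r θ : ℝ) :
    HasDerivAt (fun θ => u (pol r θ)) (r * tanD u r θ) θ := by
  have h : HasDerivAt (fun θ => pol r θ) (r • (-Real.sin θ, Real.cos θ)) θ := by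
    simpa [pol] using ((Real.hasDerivAt_cos θ).const_mul r).prodMk ((Real.hasDerivAt_sin θ).const_mul r)
  have := (hu _).hasFDerivAt.comp_hasDerivAt θ h
  rwa [map_smul] at this

lemma continuous_fderiv_pol (hu : ContDiff ℝ 1 u) {v : ℝ × ℝ → ℝ × ℝ} (hv : Continuous v) :
    Continuous fun p : ℝ × ℝ => fderiv ℝ u (pol p.1 p.2) (v p) :=
  (((hu.continuous_fderiv one_ne_zero).comp continuous_pol)).clm_apply hv

lemma continuous_radD (hu : ContDiff ℝ 1 u) : Continuous (Function.uncurry (radD u)) :=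
  continuous_fderiv_pol hu (v := fun p => (Real.cos p.2, Real.sin p.2)) (by fun_prop)

lemma continuous_tanD (hu : ContDiff ℝ 1 u) : Continuous (Function.uncurry (tanD u)) :=
  continuous_fderiv_pol hu (v := fun p => (-Real.sin p.2, Real.cos p.2)) (by fun_prop)

lemma continuous_upol (hu : ContDiff ℝ 1 u) : Continuous (Function.uncurry fun r θ => u (pol r θ)) :=
  hu.continuous.comp continuous_pol

lemma continuous_gradSq (hu : ContDiff ℝ 1 u) : Continuous (gradSq u) := by
  have h := hu.continuous_fderiv one_ne_zero
  unfold gradSq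
  exact ((h.clm_apply continuous_const).pow 2).add ((h.clm_apply continuous_const).pow 2)

end polarDerivatives

lemma testFun_exists_radius {R : ℝ} (hR : 0 < R) {u : ℝ × ℝ → ℝ} (hu : testFun (disk R) u) :
    ∃ b, 0 < b ∧ b < R ∧ tsupport u ⊆ disk b := by
  rcases (tsupport u).eq_empty_or_nonempty with h | h
  · exact ⟨R / 2, by linarith, by linarith, by simp [h]⟩
  have hc : Continuous fun p : ℝ × ℝ => p.1 ^ 2 + p.2 ^ 2 := by fun_prop
  obtain ⟨p, hp, hmax⟩ := hu.2.1.isCompact.exists_isMaxOn h hc.continuousOn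
  have hpR : p.1 ^ 2 + p.2 ^ 2 < R ^ 2 := hu.2.2 hp
  obtain ⟨b, hb1, hb2⟩ := exists_between ((Real.sqrt_lt' hR).2 hpR)
  have hb0 := (Real.sqrt_nonneg _).trans_lt hb1
  refine ⟨b, hb0, hb2, fun q hq => ?_⟩
  exact (hmax hq).trans_lt ((Real.sqrt_lt' hb0).1 hb1)

lemma gradSq_eq_zero {u : ℝ × ℝ → ℝ} {p : ℝ × ℝ} (hp : p ∉ tsupport u) : gradSq u p = 0 := by
  have : fderiv ℝ u p = 0 := by
    by_contra h
    exact hp (support_fderiv_subset ℝ h)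
  simp [gradSq, this]

lemma eq_zero_of_notMem {u : ℝ × ℝ → ℝ} {p : ℝ × ℝ} (hp : p ∉ tsupport u) : u p = 0 := by
  by_contra h
  exact hp (subset_tsupport u h)

lemma pol_notMem_disk (b θ : ℝ) : pol b θ ∉ disk b := by
  change ¬ ((pol _ θ).1 ^ 2 + (pol _ θ).2 ^ 2 < b ^ 2)
  rw [pol_sq]
  exact lt_irrefl _

lemma tcoef_add {f g : ℝ → ℝ} (hf : Continuous f) (hg : Continuous g) (j : Fin 5) :
    tcoef j (fun θ => f θ + g θ) = tcoef j f + tcoef j g := by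
  have ht := continuous_trig j
  simp only [tcoef, add_mul]
  exact intervalIntegral.integral_add ((hf.mul ht).intervalIntegrable _ _)
    ((hg.mul ht).intervalIntegrable _ _)

lemma tcoef_const_mul (c : ℝ) (f : ℝ → ℝ) (j : Fin 5) :
    tcoef j (fun θ => c * f θ) = c * tcoef j f := by
  simp only [tcoef, mul_assoc]
  exact intervalIntegral.integral_const_mul _ _

lemma continuous_param_integral {K : ℝ → ℝ → ℝ} (hK : Continuous (Function.uncurry K)) (a b : ℝ) :
    Continuous fun r => ∫ θ in a..b, K r θ :=
  intervalIntegral.continuous_parametric_intervalIntegral_of_continuous' hK a b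

lemma integral_sq_sub {f g : ℝ → ℝ} (hf : Continuous f) (hg : Continuous g) (t a b : ℝ) :
    ∫ θ in a..b, (g θ + -t * f θ) ^ 2 = (∫ θ in a..b, g θ ^ 2) - 2 * t * (∫ θ in a..b, f θ * g θ) +
      t ^ 2 * ∫ θ in a..b, f θ ^ 2 := by
  rw [← intervalIntegral.integral_const_mul, ← intervalIntegral.integral_const_mul,
    ← intervalIntegral.integral_sub, ← intervalIntegral.integral_add]
  · congr 1; ext θ; ring
  all_goals exact Continuous.intervalIntegrable (by fun_prop) _ _

lemma tcoef_const_eq_zero (c : ℝ) (j : Fin 5) (hj : tdeg j ≠ 0) : tcoef j (fun _ => c) = 0 := by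
  have h : ∀ g : ℝ → ℝ, (∫ θ in (-π)..π, g (2 * θ)) = 2⁻¹ * ∫ θ in (-(2 * π))..(2 * π), g θ := by
    intro g
    rw [intervalIntegral.integral_comp_mul_left g two_ne_zero, smul_eq_mul, mul_neg]
  have e1 := h Real.cos
  have e2 := h Real.sin
  fin_cases j <;> simp [tdeg] at hj <;> simp [tcoef, trig, e1, e2]

lemma continuousOn_picone {n : ℕ} {ν ε b : ℝ} {A C : ℝ → ℝ} (hε : 0 < ε) (hA : Continuous A)
    (hC : Continuous C) :
    ContinuousOn (fun r => r * (C r + n ^ 2 / r ^ 2 * A r - ν * A r)) (Icc ε b) := by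
  have h0 : ∀ r ∈ Icc ε b, r ^ 2 ≠ 0 := fun r hr => (pow_pos (hε.trans_le hr.1) 2).ne'
  have h1 : ContinuousOn (fun r : ℝ => (n : ℝ) ^ 2 / r ^ 2) (Icc ε b) :=
    continuousOn_const.div (by fun_prop) h0
  exact continuousOn_id.mul ((hC.continuousOn.add (h1.mul hA.continuousOn)).sub
    (continuousOn_const.mul hA.continuousOn))

lemma tendsto_mul_logDer_zero {n : ℕ} {ν : ℝ} {A : ℝ → ℝ} (hA : Continuous A)
    (h0 : n ≠ 0 → A 0 = 0) :
    Filter.Tendsto (fun r => A r * logDer n ν r) (nhdsWithin 0 (Ioi 0)) (nhds 0) := by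
  have hz : bes n (ν * 0 ^ 2) ≠ 0 := by simpa using (bes_zero_pos n).ne'
  have h := (hA.continuousAt (x := 0)).mul (continuousAt_logDer hz)
  have e : A 0 * logDer n ν 0 = 0 := by
    by_cases hn : n = 0
    · simp [logDer, hn]
    · simp [h0 hn]
  refine Filter.Tendsto.mono_left ?_ nhdsWithin_le_nhds
  have := h.tendsto
  rwa [Pi.mul_apply, e] at this

theorem rayleigh_lower {R ν : ℝ} (hR : 0 < R) (hν : 0 < ν) {u : ℝ × ℝ → ℝ} (hu : testFun (disk R) u)
    {ρ : ℕ → ℝ}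
    (hz : ∀ j : Fin 5, ∀ r ∈ Ioo 0 R, bes (tdeg j) (ν * r ^ 2) = 0 →
      r = ρ (tdeg j) ∧ tcoef j (fun θ => u (pol r θ)) = 0 ∧ bes (tdeg j + 1) (ν * r ^ 2) ≠ 0)
    (hz3 : ∀ r ∈ Ioo 0 R, bes 3 (ν * r ^ 2) ≠ 0) :
    ν * ∫ p, u p ^ 2 ≤ ∫ p, gradSq u p := by
  obtain ⟨b, hb0, hbR, hsupp⟩ := testFun_exists_radius hR hu
  have hu1 : ContDiff ℝ 1 u := hu.1.of_le (by exact_mod_cast le_top)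
  have hd := hu1.differentiable one_ne_zero
  set U : ℝ → ℝ → ℝ := fun r θ => u (pol r θ) with hUdef
  have hU : Continuous (Function.uncurry U) := continuous_upol hu1
  have hP := continuous_radD hu1
  have hT := continuous_tanD hu1
  have hUr : ∀ r, Continuous (U r) := fun r => hU.comp (by fun_prop : Continuous fun θ : ℝ => (r, θ))
  have hPr : ∀ r, Continuous (radD u r) := fun r => hP.comp (by fun_prop : Continuous fun θ : ℝ => (r, θ))
  have hTr : ∀ r, Continuous (tanD u r) := fun r => hT.comp (by fun_prop : Continuous fun θ : ℝ => (r, θ))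
  -- the angular Fourier coefficients and their radial derivatives
  have ha : ∀ j r, HasDerivAt (fun r => tcoef j (U r)) (tcoef j (radD u r)) r := fun j r =>
    hasDerivAt_param_integral (K := fun r θ => U r θ * trig j θ) (K' := fun r θ => radD u r θ * trig j θ)
      (hU.mul ((continuous_trig j).comp continuous_snd)) (hP.mul ((continuous_trig j).comp continuous_snd))
      (fun r θ => (hasDerivAt_rad hd r θ).mul_const _) _ _ r
  have hac : ∀ j, Continuous fun r => tcoef j (U r) := fun j =>
    continuous_iff_continuousAt.2 fun r => (ha j r).continuousAt
  have hpc : ∀ j, Continuous fun r => tcoef j (radD u r) := fun j =>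
    continuous_param_integral (K := fun r θ => radD u r θ * trig j θ)
      (hP.mul ((continuous_trig j).comp continuous_snd)) _ _
  have hI : ∀ r, HasDerivAt (fun r => ∫ θ in (-π)..π, U r θ ^ 2)
      (2 * ∫ θ in (-π)..π, U r θ * radD u r θ) r := fun r => by
    rw [← intervalIntegral.integral_const_mul]
    refine hasDerivAt_param_integral (K := fun r θ => U r θ ^ 2) (by exact hU.pow 2)
      (K' := fun r θ => 2 * (U r θ * radD u r θ)) (by exact continuous_const.mul (hU.mul hP))
      (fun r θ => ?_) _ _ r
    refine ((hasDerivAt_rad hd r θ).pow 2).congr_deriv ?_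
    simp only [hUdef]; ring
  have hIc : Continuous fun r => ∫ θ in (-π)..π, U r θ ^ 2 :=
    continuous_iff_continuousAt.2 fun r => (hI r).continuousAt
  have hIP : Continuous fun r => ∫ θ in (-π)..π, radD u r θ ^ 2 :=
    continuous_param_integral (K := fun r θ => radD u r θ ^ 2) (by exact hP.pow 2) _ _
  have hIT : Continuous fun r => ∫ θ in (-π)..π, tanD u r θ ^ 2 :=
    continuous_param_integral (K := fun r θ => tanD u r θ ^ 2) (by exact hT.pow 2) _ _
  have hUb : U b = fun _ => 0 := by
    ext θ
    exact eq_zero_of_notMem fun h => pol_notMem_disk b θ (hsupp h)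
  have hU0 : U 0 = fun _ => u 0 := by
    ext θ
    simp only [hUdef, pol, zero_mul]
    rfl
  set A : Fin 5 → ℝ → ℝ := fun j r => tcoef j (U r) ^ 2 / tnorm j with hA
  set C : Fin 5 → ℝ → ℝ := fun j r => tcoef j (radD u r) ^ 2 / tnorm j with hC
  have hAc : ∀ j, Continuous (A j) := fun j => ((hac j).pow 2).div_const _
  have hCc : ∀ j, Continuous (C j) := fun j => ((hpc j).pow 2).div_const _
  set A' : ℝ → ℝ := fun r => (∫ θ in (-π)..π, U r θ ^ 2) - ∑ j, A j r with hA'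
  set C' : ℝ → ℝ := fun r => (∫ θ in (-π)..π, radD u r θ ^ 2) - ∑ j, C j r with hC'
  have hA'c : Continuous A' := hIc.sub (continuous_finsetSum _ fun j _ => hAc j)
  have hC'c : Continuous C' := hIP.sub (continuous_finsetSum _ fun j _ => hCc j)
  set Φ : ℝ → ℝ := fun r => r * ((∫ θ in (-π)..π, radD u r θ ^ 2) +
    (∫ θ in (-π)..π, tanD u r θ ^ 2) - ν * ∫ θ in (-π)..π, U r θ ^ 2) with hΦ
  have hΦc : Continuous Φ := continuous_id.mul ((hIP.add hIT).sub (continuous_const.mul hIc))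
  -- the mode inequalities
  have hmode : ∀ j, ∀ ε ∈ Ioc 0 b, -(A j ε * logDer (tdeg j) ν ε) ≤
      ∫ r in ε..b, r * (C j r + (tdeg j : ℕ) ^ 2 / r ^ 2 * A j r - ν * A j r) := by
    intro j ε hε
    have htn := tnorm_pos j
    refine picone_mode (ρ := ρ (tdeg j)) (B := fun r => tcoef j (U r) * tcoef j (radD u r) / tnorm j)
      hν hε.1 hε.2 (fun r => ?_) (hCc j) (fun r t => ?_) ?_ (fun r hr h => ?_)
    · refine (((ha j r).pow 2).div_const _).congr_deriv ?_
      simp; ring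
    · have : 0 ≤ (tcoef j (radD u r) - t * tcoef j (U r)) ^ 2 / tnorm j := by positivity
      convert this using 1
      simp only [hA, hC]; ring
    · simp [hA, hUb, tcoef]
    · obtain ⟨h1, h2, h3⟩ := hz j r ⟨hr.1, hr.2.trans_lt hbR⟩ h
      exact ⟨h1, by simp [hA, hUdef, h2], h3⟩
  have hrem : ∀ ε ∈ Ioc 0 b, -(A' ε * logDer 3 ν ε) ≤
      ∫ r in ε..b, r * (C' r + (3 : ℕ) ^ 2 / r ^ 2 * A' r - ν * A' r) := by
    intro ε hε
    refine picone_mode (ρ := 0) (B := fun r => (∫ θ in (-π)..π, U r θ * radD u r θ) -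
      ∑ j, tcoef j (U r) * tcoef j (radD u r) / tnorm j)
      hν hε.1 hε.2 (fun r => ?_) hC'c (fun r t => ?_) ?_ (fun r hr h => ?_)
    · rw [mul_sub, Finset.mul_sum]
      refine (hI r).sub (HasDerivAt.fun_sum fun j _ => ?_)
      refine (((ha j r).pow 2).div_const _).congr_deriv ?_
      simp; ring
    · have hc : Continuous fun θ => radD u r θ + -t * U r θ :=
        (hPr r).add (continuous_const.mul (hUr r))
      have h := trig_bessel hc
      rw [integral_sq_sub (hUr r) (hPr r)] at h
      have e : ∀ j, tcoef j (fun θ => radD u r θ + -t * U r θ) ^ 2 / tnorm j = C j r -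
          2 * t * (tcoef j (U r) * tcoef j (radD u r) / tnorm j) + t ^ 2 * A j r := by
        intro j
        rw [tcoef_add (g := fun θ => -t * U r θ) (hPr r) (by exact continuous_const.mul (hUr r)),
          tcoef_const_mul]
        simp only [hA, hC]; ring
      simp only [e, Finset.sum_add_distrib, Finset.sum_sub_distrib, ← Finset.mul_sum] at h
      simp only [hA', hC']
      linarith
    · simp [hA', hA, hUb, tcoef]
    · exact absurd h (hz3 r ⟨hr.1, hr.2.trans_lt hbR⟩)
  -- pointwise lower bound
  have hpt : ∀ r, 0 < r → (∑ j, r * (C j r + (tdeg j : ℕ) ^ 2 / r ^ 2 * A j r - ν * A j r)) +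
      r * (C' r + (3 : ℕ) ^ 2 / r ^ 2 * A' r - ν * A' r) ≤ Φ r := by
    intro r hr
    have h := trig_wirtinger (f := U r) (f' := fun θ => r * tanD u r θ)
      (fun θ => hasDerivAt_ang hd r θ) (continuous_const.mul (hTr r)) (by simp [hUdef, pol])
    simp only [mul_pow, intervalIntegral.integral_const_mul] at h
    have e : (∑ j, r * (C j r + (tdeg j : ℕ) ^ 2 / r ^ 2 * A j r - ν * A j r)) =
        r * ((∑ j, C j r) + (∑ j, (tdeg j : ℝ) ^ 2 * A j r) / r ^ 2 - ν * ∑ j, A j r) := by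
      rw [← Finset.mul_sum, Finset.sum_sub_distrib, Finset.sum_add_distrib, ← Finset.mul_sum, Finset.sum_div]
      congr 4; ext j; ring
    rw [e, ← mul_add]
    simp only [hΦ]
    refine mul_le_mul_of_nonneg_left ?_ hr.le
    have h2 : ((∑ j, (tdeg j : ℝ) ^ 2 * A j r) + 9 * A' r) / r ^ 2 ≤ ∫ θ in (-π)..π, tanD u r θ ^ 2 := by
      rw [div_le_iff₀ (by positivity)]
      simp only [hA', hA]
      linarith
    rw [add_div] at h2
    have e2 : ((3 : ℕ) : ℝ) ^ 2 / r ^ 2 * A' r = 9 * A' r / r ^ 2 := by push_cast; ring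
    rw [e2]
    simp only [hA', hC'] at h2 ⊢
    linarith
  have hmain : ∀ ε ∈ Ioc 0 b, -((∑ j, A j ε * logDer (tdeg j) ν ε) + A' ε * logDer 3 ν ε) ≤
      ∫ r in ε..b, Φ r := by
    intro ε hε
    have i1 : ∀ j, IntervalIntegrable
        (fun r => r * (C j r + (tdeg j : ℕ) ^ 2 / r ^ 2 * A j r - ν * A j r)) volume ε b := fun j =>
      ContinuousOn.intervalIntegrable_of_Icc hε.2 (continuousOn_picone hε.1 (hAc j) (hCc j))
    have i2 : IntervalIntegrable
        (fun r => r * (C' r + (3 : ℕ) ^ 2 / r ^ 2 * A' r - ν * A' r)) volume ε b :=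
      ContinuousOn.intervalIntegrable_of_Icc hε.2 (continuousOn_picone hε.1 hA'c hC'c)
    have i3 : IntervalIntegrable
        (fun r => ∑ j, r * (C j r + (tdeg j : ℕ) ^ 2 / r ^ 2 * A j r - ν * A j r)) volume ε b :=
      ContinuousOn.intervalIntegrable_of_Icc hε.2
        (continuousOn_finsetSum _ fun j _ => continuousOn_picone hε.1 (hAc j) (hCc j))
    have h := intervalIntegral.integral_mono_on hε.2 (i3.add i2)
      (hΦc.intervalIntegrable _ _) (fun r hr => hpt r (hε.1.trans_le hr.1))
    rw [intervalIntegral.integral_add i3 i2, intervalIntegral.integral_finsetSum fun j _ => i1 j] at h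
    refine le_trans ?_ h
    rw [neg_add, ← Finset.sum_neg_distrib]
    exact add_le_add (Finset.sum_le_sum fun j _ => hmode j ε hε) (hrem ε hε)
  have hlim1 : Filter.Tendsto
      (fun ε => -((∑ j, A j ε * logDer (tdeg j) ν ε) + A' ε * logDer 3 ν ε))
      (nhdsWithin 0 (Ioi 0)) (nhds 0) := by
    have t1 : ∀ j, Filter.Tendsto (fun ε => A j ε * logDer (tdeg j) ν ε)
        (nhdsWithin 0 (Ioi 0)) (nhds 0) := fun j =>
      tendsto_mul_logDer_zero (hAc j) fun hj => by simp [hA, hU0, tcoef_const_eq_zero _ j hj]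
    have t2 : Filter.Tendsto (fun ε => A' ε * logDer 3 ν ε) (nhdsWithin 0 (Ioi 0)) (nhds 0) := by
      refine tendsto_mul_logDer_zero hA'c fun _ => ?_
      have hpi := Real.pi_ne_zero
      have e := fun j hj => tcoef_const_eq_zero (u 0) j hj
      simp only [hA', hA, hU0, Fin.sum_univ_five, e 1 (by simp [tdeg]), e 2 (by simp [tdeg]),
        e 3 (by simp [tdeg]), e 4 (by simp [tdeg])]
      simp [tcoef, trig, tnorm]
      field_simp
      ring
    simpa using ((tendsto_finsetSum _ fun j _ => t1 j).add t2).neg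
  have hlim2 : Filter.Tendsto (fun ε => ∫ r in ε..b, Φ r) (nhdsWithin 0 (Ioi 0))
      (nhds (∫ r in (0)..b, Φ r)) := by
    have : Continuous fun ε => ∫ r in ε..b, Φ r := by
      have h := (intervalIntegral.continuous_primitive (μ := volume) (fun x y => hΦc.intervalIntegrable x y) b).neg
      refine h.congr fun ε => ?_
      exact (intervalIntegral.integral_symm _ _).symm
    exact (this.tendsto 0).mono_left nhdsWithin_le_nhds
  have hfin : 0 ≤ ∫ r in (0)..b, Φ r :=
    le_of_tendsto_of_tendsto hlim1 hlim2 (Filter.eventually_of_mem (Ioc_mem_nhdsGT hb0) hmain)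
  have hcg := continuous_gradSq hu1
  have hF := integral_polar (F := fun p => gradSq u p - ν * u p ^ 2) (b := b)
    (hcg.sub (continuous_const.mul (hu1.continuous.pow 2))) hb0 (fun p hp => by
      have : p ∉ tsupport u := fun h => hp (hsupp h)
      simp [gradSq_eq_zero this, eq_zero_of_notMem this])
  have hE : ∫ p, (gradSq u p - ν * u p ^ 2) = ∫ r in (0)..b, Φ r := by
    rw [hF]
    congr 1; ext r
    simp only [hΦ, gradSq_pol]
    congr 1
    rw [← intervalIntegral.integral_const_mul, ← intervalIntegral.integral_add,
      ← intervalIntegral.integral_sub]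
    all_goals have h1 := hUr r; have h2 := hPr r; have h3 := hTr r
    · exact Continuous.intervalIntegrable (by fun_prop) _ _
    · exact Continuous.intervalIntegrable (by fun_prop) _ _
    · exact Continuous.intervalIntegrable (by fun_prop) _ _
    · exact Continuous.intervalIntegrable (by fun_prop) _ _
  have hs : HasCompactSupport u := hu.2.1
  rw [integral_sub, integral_const_mul] at hE
  · linarith
  · exact hcg.integrable_of_hasCompactSupport (hs.mono' fun p hp => by
      by_contra h
      exact hp (gradSq_eq_zero h))
  · refine (Continuous.integrable_of_hasCompactSupport (hu1.continuous.pow 2) ?_).const_mul _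
    exact hs.mono' fun p hp => by
      by_contra h
      exact hp (by simp [eq_zero_of_notMem h])

/-- The space of Dirichlet test functions. -/
def testSpace (ω : Set (ℝ × ℝ)) : Submodule ℝ (ℝ × ℝ → ℝ) where
  carrier := {u | testFun ω u}
  add_mem' {u v} hu hv := ⟨hu.1.add hv.1, hu.2.1.add hv.2.1,
    (tsupport_add u v).trans (union_subset hu.2.2 hv.2.2)⟩
  zero_mem' := ⟨contDiff_const, HasCompactSupport.zero, by simp [tsupport, Function.support_zero]⟩
  smul_mem' c u hu := ⟨contDiff_const.smul hu.1, hu.2.1.smul_left (f := fun _ => c),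
    (tsupport_smul_subset_right (fun _ => c) u).trans hu.2.2⟩

section testFun

variable {ω : Set (ℝ × ℝ)} {R : ℝ} {u : ℝ × ℝ → ℝ}

lemma testFun.contDiff_one (hu : testFun ω u) : ContDiff ℝ 1 u :=
  hu.1.of_le (by exact_mod_cast le_top)

lemma testFun.integrable_gradSq (hu : testFun ω u) : Integrable (gradSq u) :=
  (continuous_gradSq hu.contDiff_one).integrable_of_hasCompactSupport
    (HasCompactSupport.mono' hu.2.1 fun p hp => by
      by_contra h
      exact hp (gradSq_eq_zero h))

lemma testFun.integral_sq_pos (hu : testFun ω u) (h0 : u ≠ 0) : 0 < ∫ p, u p ^ 2 := by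
  have hs : HasCompactSupport fun p => u p ^ 2 := HasCompactSupport.mono' hu.2.1 fun p hp => by
    by_contra h
    exact hp (by simp [eq_zero_of_notMem h])
  refine Continuous.integral_pos_of_hasCompactSupport_nonneg_nonzero (x := (Function.ne_iff.1 h0).choose)
    (hu.1.continuous.pow 2) hs (fun p => sq_nonneg _) (pow_ne_zero 2 (Function.ne_iff.1 h0).choose_spec)

lemma testFun.rayleigh_eq (hu : testFun ω u) :
    rayleigh ω u = (∫ p, gradSq u p) / ∫ p, u p ^ 2 := by
  rw [rayleigh, setIntegral_eq_integral_of_forall_compl_eq_zero,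
    setIntegral_eq_integral_of_forall_compl_eq_zero]
  · intro p hp
    simp [eq_zero_of_notMem fun h => hp (hu.2.2 h)]
  · intro p hp
    exact gradSq_eq_zero fun h => hp (hu.2.2 h)

lemma testFun.rayleigh_nonneg (hu : testFun ω u) : 0 ≤ rayleigh ω u := by
  rw [hu.rayleigh_eq]
  exact div_nonneg (integral_nonneg fun p => by unfold gradSq; positivity)
    (integral_nonneg fun p => sq_nonneg _)

end testFun

lemma gradSq_sum_le {k : ℕ} {b : Fin k → ℝ × ℝ → ℝ} (hb : ∀ i, Differentiable ℝ (b i))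
    (c : Fin k → ℝ) (p : ℝ × ℝ) :
    gradSq (∑ i, c i • b i) p ≤ (∑ i, c i ^ 2) * ∑ i, gradSq (b i) p := by
  have e : ∀ v, fderiv ℝ (∑ i, c i • b i) p v = ∑ i, c i * fderiv ℝ (b i) p v := by
    intro v
    rw [fderiv_sum fun i _ => (hb i p).const_smul (c i), sum_apply]
    refine Finset.sum_congr rfl fun i _ => ?_
    rw [fderiv_const_smul (hb i p)]
    rfl
  simp only [gradSq, e, Finset.sum_add_distrib, mul_add]
  exact add_le_add (Finset.sum_mul_sq_le_sq_mul_sq _ _ _) (Finset.sum_mul_sq_le_sq_mul_sq _ _ _)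

lemma exists_rayleigh_bound {R : ℝ} {V : Submodule ℝ (ℝ × ℝ → ℝ)} [FiniteDimensional ℝ V]
    (hV : ∀ u ∈ V, testFun (disk R) u) :
    BddAbove {r | ∃ u ∈ V, u ≠ 0 ∧ r = rayleigh (disk R) u} := by
  set k := Module.finrank ℝ V
  let b : Module.Basis (Fin k) ℝ V := Module.finBasis ℝ V
  let f : Fin k → ℝ × ℝ → ℝ := fun i => (b i : ℝ × ℝ → ℝ)
  have hf : ∀ i, testFun (disk R) (f i) := fun i => hV _ (b i).2
  let w : (Fin k → ℝ) → ℝ × ℝ → ℝ := fun c => ∑ i, c i • f i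
  have hwV : ∀ c, w c ∈ V := fun c => Submodule.sum_mem _ fun i _ => V.smul_mem _ (b i).2
  have hwrep : ∀ u : V, w (b.repr u) = u := by
    intro u
    have := congrArg V.subtype (b.sum_repr u)
    rwa [map_sum] at this
  have hw0 : ∀ c, w c = 0 → c = 0 := by
    intro c hc
    have h : ∑ i, c i • b i = 0 := by
      apply Subtype.ext
      simpa [w, f] using hc
    exact funext (Fintype.linearIndependent_iff.1 b.linearIndependent c h)
  have hwsmul : ∀ (t : ℝ) c, w (t • c) = t • w c := by
    intro t c
    simp [w, Finset.smul_sum, mul_smul]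
  have hMc : Continuous fun c => ∫ p, w c p ^ 2 := by
    have e : (fun c => ∫ p, w c p ^ 2) = fun c => ∫ p in Metric.closedBall 0 |R|, w c p ^ 2 := by
      ext c
      rw [setIntegral_eq_integral_of_forall_compl_eq_zero]
      intro p hp
      have : p ∉ tsupport (w c) := by
        intro h
        have h1 : p.1 ^ 2 + p.2 ^ 2 < R ^ 2 := (hV _ (hwV c)).2.2 h
        apply hp
        rw [mem_closedBall_zero_iff, Prod.norm_def]
        exact max_le (sq_le_sq.1 (by nlinarith [sq_nonneg p.2]))
          (sq_le_sq.1 (by nlinarith [sq_nonneg p.1]))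
      simp [eq_zero_of_notMem this]
    rw [e]
    refine continuous_parametric_integral_of_continuous (f := fun c p => w c p ^ 2) ?_
      (isCompact_closedBall _ _)
    have : Continuous fun q : (Fin k → ℝ) × (ℝ × ℝ) => ∑ i, q.1 i * f i q.2 :=
      continuous_finsetSum _ fun i _ => ((continuous_apply i).comp continuous_fst).mul
        ((hf i).1.continuous.comp continuous_snd)
    refine (this.pow 2).congr fun q => ?_
    simp [Function.uncurry, w]
  set K := ∑ i, ∫ p, gradSq (f i) p
  have hEle : ∀ c, ∫ p, gradSq (w c) p ≤ (∑ i, c i ^ 2) * K := by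
    intro c
    have h1 := integral_mono (hV _ (hwV c)).integrable_gradSq
      ((integrable_finsetSum Finset.univ fun i _ => (hf i).integrable_gradSq).const_mul (∑ i, c i ^ 2))
      (fun p => gradSq_sum_le (fun i => (hf i).contDiff_one.differentiable one_ne_zero) c p)
    rwa [integral_const_mul, integral_finsetSum _ fun i _ => (hf i).integrable_gradSq] at h1
  have hK : 0 ≤ K := Finset.sum_nonneg fun i _ => integral_nonneg fun p => by unfold gradSq; positivity
  rcases (Metric.sphere (0 : Fin k → ℝ) 1).eq_empty_or_nonempty with hemp | hne
  · refine ⟨0, ?_⟩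
    rintro _ ⟨u, hu, hu0, rfl⟩
    exfalso
    have hc : (b.repr ⟨u, hu⟩ : Fin k → ℝ) ≠ 0 := by
      intro h
      have := hwrep ⟨u, hu⟩
      rw [h] at this
      exact hu0 (this.symm.trans (by simp [w]))
    have hn := norm_pos_iff.2 hc
    have : (‖(b.repr ⟨u, hu⟩ : Fin k → ℝ)‖⁻¹ • (b.repr ⟨u, hu⟩ : Fin k → ℝ)) ∈
        Metric.sphere (0 : Fin k → ℝ) 1 := by
      rw [mem_sphere_zero_iff_norm, norm_smul, norm_inv, norm_norm, inv_mul_cancel₀ hn.ne']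
    rw [hemp] at this
    exact this
  · obtain ⟨c0, hc0, hmin⟩ := (isCompact_sphere (0 : Fin k → ℝ) 1).exists_isMinOn hne hMc.continuousOn
    set δ := ∫ p, w c0 p ^ 2 with hδ
    have hδ0 : 0 < δ := (hV _ (hwV c0)).integral_sq_pos fun h => by
      rw [hw0 c0 h] at hc0
      simp at hc0
    refine ⟨k * K / δ, ?_⟩
    rintro _ ⟨u, hu, hu0, rfl⟩
    set c : Fin k → ℝ := ⇑(b.repr ⟨u, hu⟩)
    have hcu : w c = u := hwrep ⟨u, hu⟩
    have hc : c ≠ 0 := by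
      intro h
      rw [h] at hcu
      exact hu0 (by rw [← hcu]; simp [w])
    have hn := norm_pos_iff.2 hc
    have hmem : ‖c‖⁻¹ • c ∈ Metric.sphere (0 : Fin k → ℝ) 1 := by
      rw [mem_sphere_zero_iff_norm, norm_smul, norm_inv, norm_norm, inv_mul_cancel₀ hn.ne']
    have h1 : δ ≤ ∫ p, w (‖c‖⁻¹ • c) p ^ 2 := hmin hmem
    rw [hwsmul, hcu] at h1
    have e : ∫ p, (‖c‖⁻¹ • u) p ^ 2 = ‖c‖⁻¹ ^ 2 * ∫ p, u p ^ 2 := by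
      rw [← integral_const_mul]
      simp [mul_pow]
    rw [e] at h1
    have h2 := hEle c
    rw [hcu] at h2
    have h3 : ∑ i, c i ^ 2 ≤ k * ‖c‖ ^ 2 := by
      calc ∑ i, c i ^ 2 ≤ ∑ _i : Fin k, ‖c‖ ^ 2 := Finset.sum_le_sum fun i _ => by
            rw [← sq_abs]
            exact pow_le_pow_left₀ (abs_nonneg _) (norm_le_pi_norm c i) 2
        _ = k * ‖c‖ ^ 2 := by simp
    have hM := (hV u hu).integral_sq_pos hu0
    rw [(hV u hu).rayleigh_eq, div_le_div_iff₀ hM hδ0]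
    have h4 : δ * ‖c‖ ^ 2 ≤ ∫ p, u p ^ 2 := by
      have := mul_le_mul_of_nonneg_right h1 (sq_nonneg ‖c‖)
      calc _ ≤ _ := this
        _ = _ := by field_simp
    calc (∫ p, gradSq u p) * δ ≤ (k * ‖c‖ ^ 2 * K) * δ := by gcongr; exact h2.trans (by gcongr)
      _ = k * K * (δ * ‖c‖ ^ 2) := by ring
      _ ≤ k * K * ∫ p, u p ^ 2 := by gcongr

lemma exists_testSpace_finrank {R : ℝ} (hR : 0 < R) (k : ℕ) : ∃ V : Submodule ℝ (ℝ × ℝ → ℝ),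
    (V : Set (ℝ × ℝ → ℝ)) ⊆ {u | testFun (disk R) u} ∧ Module.finrank ℝ V = k := by
  rcases Nat.eq_zero_or_pos k with rfl | hk
  · exact ⟨⊥, SetLike.coe_subset_coe.2 (bot_le (a := testSpace (disk R))), finrank_bot ℝ _⟩
  have hk' : (1 : ℝ) ≤ k := by exact_mod_cast hk
  let f : ∀ i : Fin k, ContDiffBump ((R * i / (2 * k), 0) : ℝ × ℝ) := fun i =>
    ⟨R / (8 * k), R / (4 * k), by positivity, by gcongr; norm_num⟩
  have hf : ∀ i, testFun (disk R) (f i) := by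
    intro i
    refine ⟨(f i).contDiff, (f i).hasCompactSupport, ?_⟩
    rw [(f i).tsupport_eq]
    rintro ⟨x, y⟩ hp
    rw [Metric.mem_closedBall, Prod.dist_eq, max_le_iff] at hp
    simp only [Real.dist_eq, f, sub_zero] at hp
    obtain ⟨h1, h2⟩ := hp
    have hi : (i : ℝ) ≤ k := by exact_mod_cast i.2.le
    have h3 : R / (4 * k) ≤ R / 4 := by gcongr; linarith
    have h4 : R * i / (2 * k) ≤ R / 2 := by
      rw [div_le_div_iff₀ (by positivity) (by positivity)]; nlinarith
    have h5 : 0 ≤ R * i / (2 * k) := by positivity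
    rw [abs_le] at h1 h2
    change x ^ 2 + y ^ 2 < R ^ 2
    nlinarith
  have hli : LinearIndependent ℝ fun i => (f i : ℝ × ℝ → ℝ) := by
    rw [Fintype.linearIndependent_iff]
    intro c hc j
    have h := congrFun hc (R * j / (2 * k), 0)
    simp only [Finset.sum_apply, Pi.smul_apply, smul_eq_mul, Pi.zero_apply] at h
    rw [Finset.sum_eq_single j] at h
    · have : f j (R * j / (2 * k), 0) = 1 :=
        (f j).one_of_mem_closedBall (Metric.mem_closedBall_self (f j).rIn_pos.le)
      rwa [this, mul_one] at h
    · intro i _ hij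
      rw [(f i).zero_of_le_dist, mul_zero]
      rw [Prod.dist_eq]
      refine le_max_of_le_left ?_
      simp only [Real.dist_eq, f]
      have : (1 : ℝ) ≤ |(j : ℝ) - i| := by
        have : (j : ℤ) - i ≠ 0 := by
          intro h; apply hij; ext; omega
        exact_mod_cast Int.one_le_abs this
      rw [show R * j / (2 * k) - R * i / (2 * k) = R / (2 * k) * (j - i) by ring, abs_mul,
        abs_of_pos (by positivity)]
      calc R / (4 * k) ≤ R / (2 * k) * 1 := by rw [mul_one]; gcongr; norm_num
        _ ≤ _ := by gcongr
    · simp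
  refine ⟨Submodule.span ℝ (range fun i => (f i : ℝ × ℝ → ℝ)), fun u hu => ?_, ?_⟩
  · exact (Submodule.span_le (p := testSpace (disk R))).2 (by rintro _ ⟨i, rfl⟩; exact hf i) hu
  · rw [finrank_span_eq_card hli, Fintype.card_fin]

theorem le_dirichletEV {R ν : ℝ} (hR : 0 < R) {k m : ℕ} (hmk : m < k) (J : Fin m → Fin 5)
    (ρ : Fin m → ℝ)
    (h : ∀ u, testFun (disk R) u → (∀ i, tcoef (J i) (fun θ => u (pol (ρ i) θ)) = 0) →
      ν * ∫ p, u p ^ 2 ≤ ∫ p, gradSq u p) : ν ≤ dirichletEV (disk R) k := by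
  refine le_csInf ?_ ?_
  · obtain ⟨V, h1, h2⟩ := exists_testSpace_finrank hR k
    exact ⟨_, V, h1, h2, rfl⟩
  rintro _ ⟨V, hV, hk, rfl⟩
  have : FiniteDimensional ℝ V := Module.finite_of_finrank_pos (by omega)
  have hcont : ∀ (u : V) i, Continuous fun θ => (u : ℝ × ℝ → ℝ) (pol (ρ i) θ) := fun u i =>
    (hV u.2).1.continuous.comp (continuous_pol.comp (by fun_prop : Continuous fun θ : ℝ => (ρ i, θ)))
  let L : V →ₗ[ℝ] (Fin m → ℝ) :=
    { toFun := fun u i => tcoef (J i) fun θ => (u : ℝ × ℝ → ℝ) (pol (ρ i) θ)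
      map_add' := fun u v => funext fun i => tcoef_add (hcont u i) (hcont v i) (J i)
      map_smul' := fun c u => funext fun i => tcoef_const_mul c _ (J i) }
  obtain ⟨u, huL, hu0⟩ := Submodule.exists_mem_ne_zero_of_ne_bot
    (LinearMap.ker_ne_bot_of_finrank_lt (f := L) (by simpa [hk] using hmk))
  have hu0' : (u : ℝ × ℝ → ℝ) ≠ 0 := fun h => hu0 (Subtype.ext h)
  have ht := hV u.2
  refine le_trans ?_ (le_csSup (exists_rayleigh_bound fun u hu => hV hu) ⟨u, u.2, hu0', rfl⟩)
  rw [testFun.rayleigh_eq ht, le_div_iff₀ (testFun.integral_sq_pos ht hu0')]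
  exact h u ht fun i => congrFun (LinearMap.mem_ker.1 huL) i

lemma exists_smoothTransition_deriv_bound : ∃ C, 0 < C ∧
    ∀ x ∈ Icc (0 : ℝ) 1, |deriv Real.smoothTransition x| ≤ C := by
  have hc : Continuous (deriv Real.smoothTransition) :=
    Real.smoothTransition.contDiff.continuous_deriv (n := 1) le_rfl
  obtain ⟨C, hC⟩ := (isCompact_Icc (a := (0 : ℝ)) (b := 1)).exists_bound_of_continuousOn hc.continuousOn
  exact ⟨max C 1, by positivity, fun x hx => (hC x hx).trans (le_max_left _ _)⟩

/-- Smooth cutoff equal to `1` below `S - 2ε` and `0` above `S - ε`. -/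
def cutoff (S ε s : ℝ) : ℝ := Real.smoothTransition ((S - s) / ε - 1)

lemma contDiff_cutoff (S ε : ℝ) : ContDiff ℝ (⊤ : ℕ∞) (cutoff S ε) :=
  Real.smoothTransition.contDiff.comp (by fun_prop)

lemma cutoff_eq_zero {S ε s : ℝ} (hε : 0 < ε) (hs : S - ε ≤ s) : cutoff S ε s = 0 := by
  refine Real.smoothTransition.zero_of_nonpos ?_
  rw [sub_nonpos, div_le_one hε]
  linarith

lemma cutoff_eq_one {S ε s : ℝ} (hε : 0 < ε) (hs : s ≤ S - 2 * ε) : cutoff S ε s = 1 := by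
  refine Real.smoothTransition.one_of_one_le ?_
  rw [le_sub_iff_add_le, le_div_iff₀ hε]
  linarith

lemma deriv_cutoff_eq_zero_left {S ε s : ℝ} (hε : 0 < ε) (hs : s < S - 2 * ε) :
    deriv (cutoff S ε) s = 0 := by
  have : cutoff S ε =ᶠ[nhds s] fun _ => 1 :=
    Filter.eventually_of_mem (Iio_mem_nhds hs) fun x hx => cutoff_eq_one hε (le_of_lt hx)
  rw [this.deriv_eq, deriv_const]

lemma deriv_cutoff_eq_zero_right {S ε s : ℝ} (hε : 0 < ε) (hs : S - ε < s) :
    deriv (cutoff S ε) s = 0 := by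
  have : cutoff S ε =ᶠ[nhds s] fun _ => 0 :=
    Filter.eventually_of_mem (Ioi_mem_nhds hs) fun x hx => cutoff_eq_zero hε (le_of_lt hx)
  rw [this.deriv_eq, deriv_const]

lemma abs_deriv_cutoff_le {S ε s C : ℝ} (hε : 0 < ε) (hC0 : 0 < C)
    (hC : ∀ x ∈ Icc (0 : ℝ) 1, |deriv Real.smoothTransition x| ≤ C) :
    |deriv (cutoff S ε) s| ≤ C / ε := by
  rcases lt_or_ge s (S - 2 * ε) with h1 | h1
  · rw [deriv_cutoff_eq_zero_left hε h1, abs_zero]; positivity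
  rcases lt_or_ge (S - ε) s with h2 | h2
  · rw [deriv_cutoff_eq_zero_right hε h2, abs_zero]; positivity
  have hd : HasDerivAt (cutoff S ε) (deriv Real.smoothTransition ((S - s) / ε - 1) * (-1 / ε)) s := by
    refine HasDerivAt.comp s (((Real.smoothTransition.contDiff (n := 1)).differentiable
      one_ne_zero).differentiableAt.hasDerivAt) ?_
    exact (((hasDerivAt_id s).const_sub S).div_const ε).sub_const 1
  rw [hd.deriv, abs_mul, abs_div, abs_neg, abs_one, abs_of_pos hε, mul_one_div]
  refine div_le_div_of_nonneg_right (hC _ ⟨?_, ?_⟩) hε.le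
  · rw [sub_nonneg, one_le_div hε]; linarith
  · rw [sub_le_iff_le_add, div_le_iff₀ hε]; linarith

lemma hasDerivAt_bes_mul (n : ℕ) (μ s : ℝ) :
    HasDerivAt (fun s => bes n (μ * s)) (-(μ / 4) * bes (n + 1) (μ * s)) s := by
  have := (hasDerivAt_bes n (μ * s)).comp s ((hasDerivAt_id s).const_mul μ)
  refine this.congr_deriv ?_
  ring

/-- Bessel's equation in the variable `s = r²`. -/
lemma hasDerivAt_bes_flux (n : ℕ) (μ s : ℝ) :
    HasDerivAt (fun s => 4 * s ^ (n + 1) * (-(μ / 4) * bes (n + 1) (μ * s)))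
      (-μ * (s ^ n * bes n (μ * s))) s := by
  have := ((hasDerivAt_pow (n + 1) s).const_mul 4).mul
    ((hasDerivAt_bes_mul (n + 1) μ s).const_mul (-(μ / 4)))
  refine this.congr_deriv ?_
  have h := bes_rec n (μ * s)
  rw [show bes n (μ * s) = (n + 1) * bes (n + 1) (μ * s) + -(μ * s / 4) * bes (n + 2) (μ * s) by linarith]
  simp only [Nat.add_sub_cancel]
  push_cast
  ring

lemma cutoff_energy {n : ℕ} {S ε μ : ℝ} (hε : 0 < ε) :
    ∫ s in (0)..S, 4 * s ^ (n + 1) * deriv (fun s => cutoff S ε s * bes n (μ * s)) s ^ 2 =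
      (∫ s in (0)..S, 4 * s ^ (n + 1) * (deriv (cutoff S ε) s * bes n (μ * s)) ^ 2) +
      μ * ∫ s in (0)..S, s ^ n * (cutoff S ε s * bes n (μ * s)) ^ 2 := by
  have hχ1 : ContDiff ℝ 1 (cutoff S ε) := (contDiff_cutoff S ε).of_le (by exact_mod_cast le_top)
  have hχ : ∀ s, HasDerivAt (cutoff S ε) (deriv (cutoff S ε) s) s := fun s =>
    (hχ1.differentiable one_ne_zero).differentiableAt.hasDerivAt
  have hχc : Continuous (deriv (cutoff S ε)) := hχ1.continuous_deriv le_rfl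
  have hχc0 := hχ1.continuous
  have hb : ∀ m, Continuous fun s => bes m (μ * s) := fun m => (continuous_bes m).comp (by fun_prop)
  have hb0 := hb n
  have hb1 := hb (n + 1)
  have hg : ∀ s, deriv (fun s => cutoff S ε s * bes n (μ * s)) s =
      deriv (cutoff S ε) s * bes n (μ * s) + cutoff S ε s * (-(μ / 4) * bes (n + 1) (μ * s)) :=
    fun s => ((hχ s).mul (hasDerivAt_bes_mul n μ s)).deriv
  simp only [hg]
  have hk : ∀ s, HasDerivAt (fun s => cutoff S ε s ^ 2 * (bes n (μ * s) *
      (4 * s ^ (n + 1) * (-(μ / 4) * bes (n + 1) (μ * s)))))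
      (4 * s ^ (n + 1) * (deriv (cutoff S ε) s * bes n (μ * s) + cutoff S ε s * (-(μ / 4) * bes (n + 1) (μ * s))) ^ 2
        - (4 * s ^ (n + 1) * (deriv (cutoff S ε) s * bes n (μ * s)) ^ 2 +
          μ * (s ^ n * (cutoff S ε s * bes n (μ * s)) ^ 2))) s := by
    intro s
    refine (((hχ s).pow 2).mul ((hasDerivAt_bes_mul n μ s).mul (hasDerivAt_bes_flux n μ s))).congr_deriv ?_
    simp only [Pi.mul_apply, Pi.pow_apply]
    push_cast
    ring
  have hint := intervalIntegral.integral_eq_sub_of_hasDerivAt (a := 0) (b := S) (fun s _ => hk s)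
    (Continuous.intervalIntegrable (by fun_prop) _ _)
  rw [cutoff_eq_zero hε (by linarith : S - ε ≤ S)] at hint
  simp only [ne_eq, OfNat.ofNat_ne_zero, not_false_eq_true, zero_pow, zero_mul, Nat.add_eq_zero_iff,
    one_ne_zero, and_false, mul_zero, sub_zero] at hint
  rw [intervalIntegral.integral_sub, intervalIntegral.integral_add,
    intervalIntegral.integral_const_mul μ] at hint
  · linarith
  all_goals exact Continuous.intervalIntegrable (by fun_prop) _ _

lemma exists_radial_profile {n : ℕ} {S s₀ μ' : ℝ} (hS : 0 < S) (hs₀ : 0 < s₀) (hz : bes n s₀ = 0)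
    (hμ' : s₀ / S < μ') : ∃ g : ℝ → ℝ, ContDiff ℝ (⊤ : ℕ∞) g ∧
      (∃ ε > 0, ∀ s, S - ε ≤ s → g s = 0) ∧ (∃ s ∈ Ioo 0 S, g s ≠ 0) ∧
      ∫ s in (0)..S, 4 * s ^ (n + 1) * deriv g s ^ 2 ≤ μ' * ∫ s in (0)..S, s ^ n * g s ^ 2 := by
  set μ := s₀ / S with hμ
  have hμ0 : 0 < μ := by positivity
  obtain ⟨C, hC0, hC⟩ := exists_smoothTransition_deriv_bound
  have hb : ∀ m, Continuous fun s => bes m (μ * s) := fun m => (continuous_bes m).comp (by fun_prop)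
  have hb0 := hb n
  obtain ⟨L, hL⟩ := (isCompact_Icc (a := (0 : ℝ)) (b := S)).exists_bound_of_continuousOn
    (f := fun s => -(μ / 4) * bes (n + 1) (μ * s)) (continuous_const.mul (hb (n + 1))).continuousOn
  have hL0 : 0 ≤ L := (norm_nonneg _).trans (hL 0 ⟨le_rfl, hS.le⟩)
  have hzS : bes n (μ * S) = 0 := by rw [hμ, div_mul_cancel₀ _ hS.ne', hz]
  have hlip : ∀ s ∈ Icc 0 S, |bes n (μ * s)| ≤ L * (S - s) := by
    intro s hs
    have := (convex_Icc 0 S).norm_image_sub_le_of_norm_hasDerivWithin_le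
      (fun x _ => (hasDerivAt_bes_mul n μ x).hasDerivWithinAt) hL (right_mem_Icc.2 hS.le) hs
    rw [hzS, sub_zero, Real.norm_eq_abs, Real.norm_eq_abs, abs_sub_comm,
      abs_of_nonneg (sub_nonneg.2 hs.2)] at this
    exact this
  -- positivity near the origin
  have hnear : ∃ s ∈ Ioo 0 (S / 2), bes n (μ * s) ≠ 0 := by
    have h0 : (fun s => bes n (μ * s)) 0 ≠ 0 := by simpa using (bes_zero_pos n).ne'
    have hev := (hb0.continuousAt.eventually_ne h0).filter_mono (nhdsWithin_le_nhds (s := Ioi 0))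
    obtain ⟨s, hs1, hs2⟩ := (hev.and (Ioo_mem_nhdsGT (by positivity : (0 : ℝ) < S / 2))).exists
    exact ⟨s, hs2, hs1⟩
  obtain ⟨s₁, hs₁, hs₁0⟩ := hnear
  set m := ∫ s in (0)..(S / 2), s ^ n * bes n (μ * s) ^ 2 with hm
  have hm0 : 0 < m := by
    refine intervalIntegral.integral_pos (by linarith) (by fun_prop) (fun s hs => ?_)
      ⟨s₁, Ioo_subset_Icc_self hs₁, ?_⟩
    · have := hs.1.le
      positivity
    · have := hs₁.1
      positivity
  set Q := 32 * S ^ (n + 1) * C ^ 2 * L ^ 2 with hQ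
  have hQ0 : 0 ≤ Q := by positivity
  set ε := min (S / 4) ((μ' - μ) * m / (Q + 1)) with hεdef
  have hdm : 0 < (μ' - μ) * m := mul_pos (sub_pos.2 hμ') hm0
  have hε : 0 < ε := lt_min (by positivity) (by positivity)
  have hε1 : ε ≤ S / 4 := min_le_left _ _
  have hε2 : Q * ε ≤ (μ' - μ) * m := by
    have h := min_le_right (S / 4) ((μ' - μ) * m / (Q + 1))
    rw [← hεdef, le_div_iff₀ (by positivity)] at h
    nlinarith
  have hχ1 : ContDiff ℝ 1 (cutoff S ε) := (contDiff_cutoff S ε).of_le (by exact_mod_cast le_top)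
  have hχc : Continuous (deriv (cutoff S ε)) := hχ1.continuous_deriv le_rfl
  have hχc0 := hχ1.continuous
  refine ⟨fun s => cutoff S ε s * bes n (μ * s), ?_, ⟨ε, hε, fun s hs => ?_⟩,
    ⟨s₁, ⟨hs₁.1, by linarith [hs₁.2]⟩, ?_⟩, ?_⟩
  · exact (contDiff_cutoff S ε).mul ((contDiff_bes n).comp (by fun_prop))
  · simp [cutoff_eq_zero hε hs]
  · simp only
    rwa [cutoff_eq_one hε (by linarith [hs₁.2]), one_mul]
  rw [cutoff_energy hε]
  have h1 : m ≤ ∫ s in (0)..S, s ^ n * (cutoff S ε s * bes n (μ * s)) ^ 2 := by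
    have e : m = ∫ s in (0)..(S / 2), s ^ n * (cutoff S ε s * bes n (μ * s)) ^ 2 := by
      refine intervalIntegral.integral_congr fun s hs => ?_
      rw [uIcc_of_le (by linarith)] at hs
      rw [cutoff_eq_one hε (by linarith [hs.2]), one_mul]
    rw [e]
    refine intervalIntegral.integral_mono_interval le_rfl (by linarith) (by linarith) ?_
      (Continuous.intervalIntegrable (by fun_prop) _ _)
    filter_upwards [ae_restrict_mem measurableSet_Ioc] with s hs
    have := hs.1.le
    simp only [Pi.zero_apply]
    positivity
  have h2 : ∫ s in (0)..S, 4 * s ^ (n + 1) * (deriv (cutoff S ε) s * bes n (μ * s)) ^ 2 ≤ Q * ε := by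
    have hi : ∀ a b, IntervalIntegrable
        (fun s => 4 * s ^ (n + 1) * (deriv (cutoff S ε) s * bes n (μ * s)) ^ 2) volume a b :=
      fun a b => Continuous.intervalIntegrable (by fun_prop) _ _
    rw [← intervalIntegral.integral_add_adjacent_intervals (hi 0 (S - 2 * ε)) (hi (S - 2 * ε) S)]
    have z : ∫ s in (0)..(S - 2 * ε), 4 * s ^ (n + 1) * (deriv (cutoff S ε) s * bes n (μ * s)) ^ 2 = 0 := by
      rw [intervalIntegral.integral_of_le (by linarith), integral_Ioc_eq_integral_Ioo]
      refine setIntegral_eq_zero_of_forall_eq_zero fun s hs => ?_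
      rw [deriv_cutoff_eq_zero_left hε hs.2]
      simp
    rw [z, zero_add]
    have hbd : ∀ s ∈ Icc (S - 2 * ε) S, 4 * s ^ (n + 1) * (deriv (cutoff S ε) s * bes n (μ * s)) ^ 2 ≤ Q / 2 := by
      intro s hs
      have hs0 : 0 ≤ s := by linarith [hs.1]
      have i1 := abs_deriv_cutoff_le (S := S) (s := s) hε hC0 hC
      have i2 : |bes n (μ * s)| ≤ L * (2 * ε) :=
        (hlip s ⟨hs0, hs.2⟩).trans (mul_le_mul_of_nonneg_left (by linarith [hs.1]) hL0)
      have i3 : |deriv (cutoff S ε) s * bes n (μ * s)| ≤ 2 * C * L := by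
        rw [abs_mul]
        calc _ ≤ (C / ε) * (L * (2 * ε)) := by gcongr
          _ = _ := by field_simp
      have i4 : (deriv (cutoff S ε) s * bes n (μ * s)) ^ 2 ≤ (2 * C * L) ^ 2 := by
        rw [← sq_abs]; gcongr
      have i5 : s ^ (n + 1) ≤ S ^ (n + 1) := by gcongr; exact hs.2
      calc _ ≤ 4 * S ^ (n + 1) * (2 * C * L) ^ 2 := by gcongr
        _ = Q / 2 := by rw [hQ]; ring
    have := intervalIntegral.integral_mono_on (by linarith) (hi (S - 2 * ε) S)
      (intervalIntegrable_const (c := Q / 2)) hbd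
    refine this.trans ?_
    rw [intervalIntegral.integral_const, smul_eq_mul]
    linarith
  nlinarith [mul_le_mul_of_nonneg_left h1 (sub_pos.2 hμ').le]

lemma integral_harmonics (A p₁ p₂ p₃ p₄ q₁ q₂ q₃ q₄ : ℝ) :
    ∫ θ in (-π)..π, (A + (p₁ * Real.cos θ + q₁ * Real.sin θ) +
      (p₂ * Real.cos (2 * θ) + q₂ * Real.sin (2 * θ)) +
      (p₃ * Real.cos (3 * θ) + q₃ * Real.sin (3 * θ)) +
      (p₄ * Real.cos (4 * θ) + q₄ * Real.sin (4 * θ))) = 2 * π * A := by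
  have hd : ∀ (k : ℝ) (_ : k ≠ 0) (p q θ : ℝ), HasDerivAt
      (fun θ => p / k * Real.sin (k * θ) - q / k * Real.cos (k * θ))
      (p * Real.cos (k * θ) + q * Real.sin (k * θ)) θ := by
    intro k hk p q θ
    have h := (hasDerivAt_id θ).const_mul k
    refine ((h.sin.const_mul (p / k)).sub (h.cos.const_mul (q / k))).congr_deriv ?_
    simp only [id]
    field_simp
    ring
  have h := intervalIntegral.integral_eq_sub_of_hasDerivAt (a := -π) (b := π) (fun θ _ =>
    (((((hasDerivAt_id θ).const_mul A).add (hd 1 one_ne_zero p₁ q₁ θ)).add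
      (hd 2 two_ne_zero p₂ q₂ θ)).add (hd 3 three_ne_zero p₃ q₃ θ)).add (hd 4 four_ne_zero p₄ q₄ θ))
    (Continuous.intervalIntegrable (by fun_prop) _ _)
  have hs : ∀ k : ℕ, Real.sin (k * π) = 0 := Real.sin_nat_mul_pi
  have s2 := hs 2
  have s3 := hs 3
  have s4 := hs 4
  push_cast at s2 s3 s4
  simp only [one_mul, mul_one, Pi.add_apply, id, mul_neg, Real.sin_neg, Real.cos_neg, Real.sin_pi,
    s2, s3, s4] at h
  rw [h]
  ring

lemma integral_trig_sq (a : Fin 5 → ℝ) :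
    ∫ θ in (-π)..π, (∑ j, a j * trig j θ) ^ 2 = ∑ j, tnorm j * a j ^ 2 := by
  have h := integral_harmonics (a 0 ^ 2 + (a 1 ^ 2 + a 2 ^ 2 + a 3 ^ 2 + a 4 ^ 2) / 2)
    (2 * a 0 * a 1 + a 1 * a 3 + a 2 * a 4) (2 * a 0 * a 3 + (a 1 ^ 2 - a 2 ^ 2) / 2)
    (a 1 * a 3 - a 2 * a 4) ((a 3 ^ 2 - a 4 ^ 2) / 2)
    (2 * a 0 * a 2 + a 1 * a 4 - a 2 * a 3) (2 * a 0 * a 4 + a 1 * a 2)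
    (a 1 * a 4 + a 2 * a 3) (a 3 * a 4)
  have e : ∑ j, tnorm j * a j ^ 2 =
      2 * π * (a 0 ^ 2 + (a 1 ^ 2 + a 2 ^ 2 + a 3 ^ 2 + a 4 ^ 2) / 2) := by
    simp [Fin.sum_univ_five, tnorm]
    ring
  rw [e, ← h]
  congr 1
  ext θ
  have h1 := Real.sin_sq_add_cos_sq θ
  have h2 := Real.sin_sq_add_cos_sq (2 * θ)
  have c2 := Real.cos_two_mul θ
  have s2 := Real.sin_two_mul θ
  have c3 : Real.cos (3 * θ) = Real.cos θ * Real.cos (2 * θ) - Real.sin θ * Real.sin (2 * θ) := by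
    rw [← Real.cos_add]; ring_nf
  have s3 : Real.sin (3 * θ) = Real.sin θ * Real.cos (2 * θ) + Real.cos θ * Real.sin (2 * θ) := by
    rw [← Real.sin_add]; ring_nf
  have c4 : Real.cos (4 * θ) = 2 * Real.cos (2 * θ) ^ 2 - 1 := by
    rw [← Real.cos_two_mul]; ring_nf
  have s4 : Real.sin (4 * θ) = 2 * Real.sin (2 * θ) * Real.cos (2 * θ) := by
    rw [← Real.sin_two_mul]; ring_nf
  have e1 : Real.cos (2 * θ) * Real.cos θ + Real.sin (2 * θ) * Real.sin θ = Real.cos θ := by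
    rw [← Real.cos_sub]; ring_nf
  have e2 : Real.sin (2 * θ) * Real.cos θ - Real.cos (2 * θ) * Real.sin θ = Real.sin θ := by
    rw [← Real.sin_sub]; ring_nf
  simp [Fin.sum_univ_five, trig]
  rw [c3, s3, c4, s4]
  linear_combination (a 1 * a 3 + a 2 * a 4) * e1 + (a 1 * a 4 - a 2 * a 3) * e2 +
    a 2 ^ 2 * h1 + a 4 ^ 2 * h2 - (a 1 ^ 2 - a 2 ^ 2) / 2 * c2 - a 1 * a 2 * s2

/-- The harmonic polynomials `r^n cos nθ`, `r^n sin nθ`. -/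
def harm (j : Fin 5) (p : ℝ × ℝ) : ℝ :=
  ![1, p.1, p.2, p.1 ^ 2 - p.2 ^ 2, 2 * p.1 * p.2] j

lemma contDiff_harm (j : Fin 5) : ContDiff ℝ (⊤ : ℕ∞) (harm j) := by
  unfold harm
  fin_cases j <;> simp <;> fun_prop

lemma harm_pol (j : Fin 5) (r θ : ℝ) : harm j (pol r θ) = r ^ tdeg j * trig j θ := by
  fin_cases j <;> simp [harm, pol, tdeg, trig, Real.cos_two_mul', Real.sin_two_mul] <;> ring

/-- Angular momentum `n` mode with radial profile `g`. -/
def modeFun (g : ℝ → ℝ) (j : Fin 5) (p : ℝ × ℝ) : ℝ := harm j p * g (p.1 ^ 2 + p.2 ^ 2)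

lemma testFun_modeFun {R ε : ℝ} (hR : 0 < R) {g : ℝ → ℝ} (hg : ContDiff ℝ (⊤ : ℕ∞) g) (hε : 0 < ε)
    (h0 : ∀ s, R ^ 2 - ε ≤ s → g s = 0) (j : Fin 5) : testFun (disk R) (modeFun g j) := by
  have hsub : tsupport (modeFun g j) ⊆ {p : ℝ × ℝ | p.1 ^ 2 + p.2 ^ 2 ≤ R ^ 2 - ε} := by
    refine closure_minimal (fun p hp => ?_) (isClosed_le (by fun_prop) continuous_const)
    by_contra h
    exact hp (by simp [modeFun, h0 _ (le_of_lt (not_le.1 h))])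
  refine ⟨(contDiff_harm j).mul (hg.comp (by fun_prop)), ?_, fun p hp => ?_⟩
  · refine HasCompactSupport.of_support_subset_isCompact (isCompact_closedBall (0 : ℝ × ℝ) R)
      (fun p hp => ?_)
    have h : p.1 ^ 2 + p.2 ^ 2 ≤ R ^ 2 - ε := hsub (subset_tsupport _ hp)
    rw [mem_closedBall_zero_iff, Prod.norm_def]
    exact max_le (abs_le_of_sq_le_sq (by nlinarith [sq_nonneg p.2]) hR.le)
      (abs_le_of_sq_le_sq (by nlinarith [sq_nonneg p.1]) hR.le)
  · have hp' : p.1 ^ 2 + p.2 ^ 2 ≤ R ^ 2 - ε := hsub hp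
    change p.1 ^ 2 + p.2 ^ 2 < R ^ 2
    linarith

lemma modeFun_pol (g : ℝ → ℝ) (j : Fin 5) (r θ : ℝ) :
    modeFun g j (pol r θ) = r ^ tdeg j * g (r ^ 2) * trig j θ := by
  rw [modeFun, harm_pol, pol_sq]
  ring

/-- Coefficients of the angular derivative of a trigonometric polynomial. -/
def rotCoef (b : Fin 5 → ℝ) : Fin 5 → ℝ := ![0, b 2, -b 1, 2 * b 4, -(2 * b 3)]

lemma hasDerivAt_trig_sum (b : Fin 5 → ℝ) (θ : ℝ) :
    HasDerivAt (fun θ => ∑ j, b j * trig j θ) (∑ j, rotCoef b j * trig j θ) θ := by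
  have h2 := (hasDerivAt_id θ).const_mul 2
  have := ((((hasDerivAt_const θ (b 0)).add ((Real.hasDerivAt_cos θ).const_mul (b 1))).add
    ((Real.hasDerivAt_sin θ).const_mul (b 2))).add (h2.cos.const_mul (b 3))).add (h2.sin.const_mul (b 4))
  simp only [Fin.sum_univ_five]
  simp [trig, rotCoef]
  refine (this.congr_deriv ?_).congr_of_eventuallyEq (.of_forall fun x => ?_)
  · simp; ring
  · simp

lemma sum_rotCoef_sq (b : Fin 5 → ℝ) :
    ∑ j, tnorm j * rotCoef b j ^ 2 = ∑ j, tnorm j * ((tdeg j : ℝ) ^ 2 * b j ^ 2) := by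
  simp [Fin.sum_univ_five, tnorm, tdeg, rotCoef]
  ring

section modes

variable {R μ' : ℝ} {g : Fin 5 → ℝ → ℝ}

/-- Radial energy density, in the variable `s = r²`. -/
def modeDensity (n : ℕ) (μ' : ℝ) (g : ℝ → ℝ) (s : ℝ) : ℝ :=
  2 * n * (n * s ^ (n - 1) * g s ^ 2 + s ^ n * (2 * g s * deriv g s)) +
    4 * s ^ (n + 1) * deriv g s ^ 2 - μ' * (s ^ n * g s ^ 2)

lemma integral_modeDensity {n : ℕ} {g : ℝ → ℝ} (hg : ContDiff ℝ 1 g)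
    (h0 : g (R ^ 2) = 0) :
    ∫ r in (0)..R, r * modeDensity n μ' g (r ^ 2) =
      2⁻¹ * ((∫ s in (0)..(R ^ 2), 4 * s ^ (n + 1) * deriv g s ^ 2) -
        μ' * ∫ s in (0)..(R ^ 2), s ^ n * g s ^ 2) := by
  have hd := hg.continuous_deriv le_rfl
  have hgc := hg.continuous
  have hD : Continuous (modeDensity n μ' g) := by unfold modeDensity; fun_prop
  have h1 := intervalIntegral.integral_comp_mul_deriv (a := 0) (b := R) (f := fun r => r ^ 2)
    (f' := fun r => 2 * r) (g := modeDensity n μ' g)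
    (fun r _ => by simpa using hasDerivAt_pow 2 r) (by fun_prop) hD
  have e : ∫ r in (0)..R, r * modeDensity n μ' g (r ^ 2) =
      2⁻¹ * ∫ r in (0)..R, (modeDensity n μ' g ∘ fun r => r ^ 2) r * (2 * r) := by
    rw [← intervalIntegral.integral_const_mul]
    congr 1; ext r
    simp only [Function.comp]
    ring
  rw [e, h1, zero_pow two_ne_zero]
  congr 1
  have hk : ∀ s, HasDerivAt (fun s => 2 * n * (s ^ n * g s ^ 2))
      (2 * n * (n * s ^ (n - 1) * g s ^ 2 + s ^ n * (2 * g s * deriv g s))) s := by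
    intro s
    have h := (hg.differentiable one_ne_zero).differentiableAt.hasDerivAt (x := s)
    refine (((hasDerivAt_pow n s).mul (h.pow 2)).const_mul (2 * (n : ℝ))).congr_deriv ?_
    simp
  have hint := intervalIntegral.integral_eq_sub_of_hasDerivAt (a := 0) (b := R ^ 2) (fun s _ => hk s)
    (Continuous.intervalIntegrable (by fun_prop) _ _)
  have hz : 2 * (n : ℝ) * (0 ^ n * g 0 ^ 2) = 0 := by
    rcases Nat.eq_zero_or_pos n with rfl | hn
    · simp
    · simp [hn.ne']
  rw [hz, h0] at hint
  unfold modeDensity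
  rw [intervalIntegral.integral_sub, intervalIntegral.integral_add, hint,
    intervalIntegral.integral_const_mul μ']
  · ring
  all_goals exact Continuous.intervalIntegrable (by fun_prop) _ _

lemma modeDensity_eq (n : ℕ) (μ' : ℝ) (g : ℝ → ℝ) {r : ℝ} (hr : r ≠ 0) :
    (n * r ^ (n - 1) * g (r ^ 2) + r ^ n * (deriv g (r ^ 2) * (2 * r))) ^ 2 +
      n ^ 2 * (r ^ n * g (r ^ 2)) ^ 2 / r ^ 2 - μ' * (r ^ n * g (r ^ 2)) ^ 2 =
      modeDensity n μ' g (r ^ 2) := by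
  unfold modeDensity
  cases n with
  | zero => simp; ring
  | succ m =>
    rw [Nat.add_sub_cancel]
    push_cast
    field_simp
    ring

theorem modes_energy_le (hR : 0 < R) (hg : ∀ j, ContDiff ℝ (⊤ : ℕ∞) (g j))
    (h0 : ∀ j, ∃ ε > 0, ∀ s, R ^ 2 - ε ≤ s → g j s = 0) (a : Fin 5 → ℝ)
    (hE : ∀ j, a j ≠ 0 → ∫ s in (0)..(R ^ 2), 4 * s ^ (tdeg j + 1) * deriv (g j) s ^ 2 ≤
      μ' * ∫ s in (0)..(R ^ 2), s ^ tdeg j * g j s ^ 2) :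
    ∫ p, gradSq (∑ j, a j • modeFun (g j) j) p ≤
      μ' * ∫ p, (∑ j, a j • modeFun (g j) j) p ^ 2 := by
  set u : ℝ × ℝ → ℝ := ∑ j, a j • modeFun (g j) j with hu
  have ht : testFun (disk R) u := Submodule.sum_mem (testSpace (disk R)) fun j _ => by
    obtain ⟨ε, hε, h⟩ := h0 j
    exact (testSpace (disk R)).smul_mem _ (testFun_modeFun hR (hg j) hε h j)
  have hu1 := ht.contDiff_one
  have hd := hu1.differentiable one_ne_zero
  have hg1 : ∀ j, ContDiff ℝ 1 (g j) := fun j => (hg j).of_le (by exact_mod_cast le_top)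
  have hcg := continuous_gradSq hu1
  set H : Fin 5 → ℝ → ℝ := fun j r => r ^ tdeg j * g j (r ^ 2) with hH
  set H' : Fin 5 → ℝ → ℝ := fun j r => (tdeg j : ℕ) * r ^ (tdeg j - 1) * g j (r ^ 2) +
    r ^ tdeg j * (deriv (g j) (r ^ 2) * (2 * r)) with hH'
  have hHd : ∀ j r, HasDerivAt (H j) (H' j r) r := by
    intro j r
    have h1 := ((hg1 j).differentiable one_ne_zero).differentiableAt.hasDerivAt (x := r ^ 2)
    have h2 : HasDerivAt (fun r : ℝ => r ^ 2) (2 * r) r := by simpa using hasDerivAt_pow 2 r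
    have h3 : HasDerivAt (fun r => g j (r ^ 2)) (deriv (g j) (r ^ 2) * (2 * r)) r :=
      HasDerivAt.comp (h₂ := g j) (h := fun r : ℝ => r ^ 2) r h1 h2
    exact (hasDerivAt_pow (tdeg j) r).mul h3
  have hpol : ∀ r θ, u (pol r θ) = ∑ j, a j * H j r * trig j θ := by
    intro r θ
    rw [hu, Finset.sum_apply]
    refine Finset.sum_congr rfl fun j _ => ?_
    rw [Pi.smul_apply, modeFun_pol, smul_eq_mul]
    simp only [hH]; ring
  have hrad : ∀ r θ, radD u r θ = ∑ j, a j * H' j r * trig j θ := by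
    intro r θ
    have h1 := hasDerivAt_rad hd r θ
    simp only [hpol] at h1
    exact h1.unique (HasDerivAt.fun_sum fun j _ => ((hHd j r).const_mul (a j)).mul_const (trig j θ))
  have htan : ∀ r θ, r * tanD u r θ = ∑ j, rotCoef (fun j => a j * H j r) j * trig j θ := by
    intro r θ
    have h1 := hasDerivAt_ang hd r θ
    simp only [hpol] at h1
    exact h1.unique (hasDerivAt_trig_sum _ θ)
  have hpt : ∀ r, 0 < r → r * ∫ θ in (-π)..π, (gradSq u (pol r θ) - μ' * u (pol r θ) ^ 2) =
      ∑ j, tnorm j * a j ^ 2 * (r * modeDensity (tdeg j) μ' (g j) (r ^ 2)) := by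
    intro r hr
    have hPr : Continuous (radD u r) :=
      (continuous_radD hu1).comp (by fun_prop : Continuous fun θ : ℝ => (r, θ))
    have hTr : Continuous (tanD u r) :=
      (continuous_tanD hu1).comp (by fun_prop : Continuous fun θ : ℝ => (r, θ))
    have hUr : Continuous fun θ => u (pol r θ) :=
      (continuous_upol hu1).comp (by fun_prop : Continuous fun θ : ℝ => (r, θ))
    have i1 : ∫ θ in (-π)..π, radD u r θ ^ 2 = ∑ j, tnorm j * (a j * H' j r) ^ 2 := by
      simp only [hrad]; exact integral_trig_sq _
    have i2 : ∫ θ in (-π)..π, tanD u r θ ^ 2 =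
        (∑ j, tnorm j * ((tdeg j : ℝ) ^ 2 * (a j * H j r) ^ 2)) / r ^ 2 := by
      rw [← sum_rotCoef_sq, ← integral_trig_sq, eq_div_iff (by positivity),
        ← intervalIntegral.integral_mul_const]
      simp only [← htan]
      congr 1; ext θ; ring
    have i3 : ∫ θ in (-π)..π, u (pol r θ) ^ 2 = ∑ j, tnorm j * (a j * H j r) ^ 2 := by
      simp only [hpol]; exact integral_trig_sq _
    simp only [gradSq_pol]
    rw [intervalIntegral.integral_sub, intervalIntegral.integral_add,
      intervalIntegral.integral_const_mul, i1, i2, i3, Finset.sum_div, Finset.mul_sum,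
      ← Finset.sum_add_distrib, ← Finset.sum_sub_distrib, Finset.mul_sum]
    · refine Finset.sum_congr rfl fun j _ => ?_
      rw [← modeDensity_eq _ _ _ hr.ne']
      simp only [hH, hH']
      ring
    · exact (hPr.pow 2).intervalIntegrable _ _
    · exact (hTr.pow 2).intervalIntegrable _ _
    · exact ((hPr.pow 2).add (hTr.pow 2)).intervalIntegrable _ _
    · exact (continuous_const.mul (hUr.pow 2)).intervalIntegrable _ _
  have hF := integral_polar (F := fun p => gradSq u p - μ' * u p ^ 2) (b := R)
    (hcg.sub (continuous_const.mul (hu1.continuous.pow 2))) hR (fun p hp => by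
      have : p ∉ tsupport u := fun h => hp (ht.2.2 h)
      simp [gradSq_eq_zero this, eq_zero_of_notMem this])
  have hDc : ∀ j, Continuous fun r => r * modeDensity (tdeg j) μ' (g j) (r ^ 2) := by
    intro j
    have h1 := (hg1 j).continuous_deriv le_rfl
    have h2 := (hg1 j).continuous
    unfold modeDensity
    fun_prop
  have hE' : ∫ r in (0)..R, r * ∫ θ in (-π)..π, (gradSq u (pol r θ) - μ' * u (pol r θ) ^ 2) =
      ∑ j, tnorm j * a j ^ 2 * ∫ r in (0)..R, r * modeDensity (tdeg j) μ' (g j) (r ^ 2) := by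
    rw [intervalIntegral.integral_congr_ae (g := fun r => ∑ j, tnorm j * a j ^ 2 *
      (r * modeDensity (tdeg j) μ' (g j) (r ^ 2))), intervalIntegral.integral_finsetSum]
    · simp only [intervalIntegral.integral_const_mul]
    · exact fun j _ => (continuous_const.mul (hDc j)).intervalIntegrable _ _
    · refine .of_forall fun r hr => hpt r ?_
      rw [uIoc_of_le hR.le] at hr
      exact hr.1
  have hle : ∑ j, tnorm j * a j ^ 2 * ∫ r in (0)..R, r * modeDensity (tdeg j) μ' (g j) (r ^ 2) ≤ 0 := by
    refine Finset.sum_nonpos fun j _ => ?_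
    by_cases haj : a j = 0
    · simp [haj]
    obtain ⟨ε, hε, h⟩ := h0 j
    have htn := tnorm_pos j
    rw [integral_modeDensity (hg1 j) (h _ (by linarith))]
    have := hE j haj
    exact mul_nonpos_of_nonneg_of_nonpos (by positivity) (by linarith)
  rw [integral_sub ht.integrable_gradSq, integral_const_mul] at hF
  · linarith
  · refine (Continuous.integrable_of_hasCompactSupport (hu1.continuous.pow 2) ?_).const_mul _
    exact HasCompactSupport.mono' ht.2.1 fun p hp => by
      by_contra h
      exact hp (by simp [eq_zero_of_notMem h])

lemma linearIndependent_modeFun (hg : ∀ j, ∃ s ∈ Ioo 0 (R ^ 2), g j s ≠ 0) :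
    LinearIndependent ℝ fun j => modeFun (g j) j := by
  rw [Fintype.linearIndependent_iff]
  intro a ha j
  obtain ⟨s, hs, hgs⟩ := hg j
  have h : ∀ θ, ∑ i, a i * (√s ^ tdeg i * g i s) * trig i θ = 0 := by
    intro θ
    have := congrFun ha (pol (√s) θ)
    rw [Finset.sum_apply] at this
    refine Eq.trans (Finset.sum_congr rfl fun i _ => ?_) this
    rw [Pi.smul_apply, modeFun_pol, Real.sq_sqrt hs.1.le, smul_eq_mul]
    ring
  have h2 := integral_trig_sq fun i => a i * (√s ^ tdeg i * g i s)
  simp only [h] at h2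
  simp only [ne_eq, OfNat.ofNat_ne_zero, not_false_eq_true, zero_pow,
    intervalIntegral.integral_zero] at h2
  have h3 := (Finset.sum_eq_zero_iff_of_nonneg (fun i _ => by have := tnorm_pos i; positivity)).1
    h2.symm j (Finset.mem_univ j)
  have hsp : √s ≠ 0 := (Real.sqrt_pos.2 hs.1).ne'
  simpa [(tnorm_pos j).ne', hsp, hgs] using h3

end modes

theorem dirichletEV_le {R μ' : ℝ} (hR : 0 < R) {k : ℕ} (hk : k ≤ 5) (hμ' : 0 ≤ μ') (z : Fin 5 → ℝ)
    (hz0 : ∀ j, 0 < z j) (hz : ∀ j, bes (tdeg j) (z j) = 0)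
    (hzk : ∀ j : Fin 5, (j : ℕ) < k → z j / R ^ 2 < μ') : dirichletEV (disk R) k ≤ μ' := by
  have hg : ∀ j : Fin 5, ∃ g : ℝ → ℝ, ContDiff ℝ (⊤ : ℕ∞) g ∧
      (∃ ε > 0, ∀ s, R ^ 2 - ε ≤ s → g s = 0) ∧ (∃ s ∈ Ioo 0 (R ^ 2), g s ≠ 0) ∧
      ((j : ℕ) < k → ∫ s in (0)..(R ^ 2), 4 * s ^ (tdeg j + 1) * deriv g s ^ 2 ≤
        μ' * ∫ s in (0)..(R ^ 2), s ^ tdeg j * g s ^ 2) := by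
    intro j
    by_cases hj : (j : ℕ) < k
    · obtain ⟨g, h1, h2, h3, h4⟩ := exists_radial_profile (by positivity) (hz0 j) (hz j) (hzk j hj)
      exact ⟨g, h1, h2, h3, fun _ => h4⟩
    · obtain ⟨g, h1, h2, h3, -⟩ := exists_radial_profile (S := R ^ 2) (by positivity) (hz0 j) (hz j)
        (lt_add_one _)
      exact ⟨g, h1, h2, h3, fun h => absurd h hj⟩
  choose g hgs hg0 hgne hgE using hg
  let f : Fin k → ℝ × ℝ → ℝ := fun i => modeFun (g (Fin.castLE hk i)) (Fin.castLE hk i)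
  have hli : LinearIndependent ℝ f :=
    (linearIndependent_modeFun hgne).comp (Fin.castLE hk) (Fin.castLE_injective hk)
  set V := Submodule.span ℝ (range f)
  have hVt : ∀ u ∈ V, testFun (disk R) u := fun u hu =>
    (Submodule.span_le (p := testSpace (disk R))).2 (by
      rintro _ ⟨i, rfl⟩
      obtain ⟨ε, hε, h⟩ := hg0 (Fin.castLE hk i)
      exact testFun_modeFun hR (hgs _) hε h _) hu
  have hVrep : ∀ u ∈ V, ∃ a : Fin 5 → ℝ, (∀ j, a j ≠ 0 → (j : ℕ) < k) ∧
      u = ∑ j, a j • modeFun (g j) j := by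
    intro u hu
    induction hu using Submodule.span_induction with
    | mem u h =>
      obtain ⟨i, rfl⟩ := h
      refine ⟨Pi.single (Fin.castLE hk i) 1, fun j hj => ?_, ?_⟩
      · have : j = Fin.castLE hk i := by
          by_contra hne
          exact hj (Pi.single_eq_of_ne hne _)
        rw [this]
        exact i.2
      · simp [f, Pi.single_apply, ite_smul]
    | zero => exact ⟨0, by simp, by simp⟩
    | add u v _ _ hu hv =>
      obtain ⟨a, ha, rfl⟩ := hu
      obtain ⟨b, hb, rfl⟩ := hv
      refine ⟨a + b, fun j hj => ?_, by simp [add_smul, Finset.sum_add_distrib]⟩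
      by_cases haj : a j = 0
      · exact hb j fun h => hj (by simp [haj, h])
      · exact ha j haj
    | smul c u _ hu =>
      obtain ⟨a, ha, rfl⟩ := hu
      exact ⟨c • a, fun j hj => ha j fun h => hj (by simp [h]), by simp [Finset.smul_sum, mul_smul]⟩
  have hle : sSup {r | ∃ u ∈ V, u ≠ 0 ∧ r = rayleigh (disk R) u} ≤ μ' := by
    refine Real.sSup_le ?_ hμ'
    rintro _ ⟨u, hu, hu0, rfl⟩
    have ht := hVt u hu
    rw [ht.rayleigh_eq, div_le_iff₀ (ht.integral_sq_pos hu0)]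
    obtain ⟨a, ha, rfl⟩ := hVrep u hu
    exact modes_energy_le hR hgs hg0 a fun j hj => hgE j (ha j hj)
  refine le_trans (csInf_le ?_ ?_) hle
  · refine ⟨0, ?_⟩
    rintro _ ⟨W, hW, -, rfl⟩
    refine Real.sSup_nonneg ?_
    rintro _ ⟨u, hu, -, rfl⟩
    exact testFun.rayleigh_nonneg (hW hu)
  · exact ⟨V, fun u hu => hVt u hu, by rw [finrank_span_eq_card hli, Fintype.card_fin], rfl⟩

theorem div_sq_le_dirichletEV {R T : ℝ} (hR : 0 < R) (hT : 0 < T) {z : ℕ → ℝ}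
    (hz : ∀ n ≤ 2, ∀ s ∈ Ioo 0 T, bes n s = 0 → s = z n ∧ bes (n + 1) s ≠ 0)
    (hz3 : ∀ s ∈ Ioo 0 T, bes 3 s ≠ 0) {k m : ℕ} (hmk : m < k) (J : Fin m → Fin 5)
    (hJ : ∀ j, z (tdeg j) < T → ∃ i, J i = j) : T / R ^ 2 ≤ dirichletEV (disk R) k := by
  have hν : 0 < T / R ^ 2 := by positivity
  have hmem : ∀ r ∈ Ioo 0 R, T / R ^ 2 * r ^ 2 ∈ Ioo 0 T := by
    rintro r ⟨h0, h1⟩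
    refine ⟨by positivity, ?_⟩
    rw [div_mul_eq_mul_div, div_lt_iff₀ (by positivity)]
    exact mul_lt_mul_of_pos_left (pow_lt_pow_left₀ h1 h0.le two_ne_zero) hT
  have hdeg : ∀ j, tdeg j ≤ 2 := by decide
  refine le_dirichletEV hR hmk J (fun i => √(z (tdeg (J i)) / (T / R ^ 2))) fun u hu hc => ?_
  refine rayleigh_lower hR hν hu (ρ := fun n => √(z n / (T / R ^ 2))) (fun j r hr h => ?_)
    fun r hr => hz3 _ (hmem r hr)
  obtain ⟨h1, h2⟩ := hz _ (hdeg j) _ (hmem r hr) h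
  have hrρ : r = √(z (tdeg j) / (T / R ^ 2)) := by
    rw [← h1, mul_div_cancel_left₀ _ hν.ne', Real.sqrt_sq hr.1.le]
  obtain ⟨i, hi⟩ := hJ j (h1 ▸ (hmem r hr).2)
  have hci := hc i
  simp only [hi] at hci
  exact ⟨hrρ, by rw [hrρ]; exact hci, h2⟩

/-- the first six Dirichlet eigenvalues of a disk satisfy
`λ₁ < λ₂ = λ₃ < λ₄ = λ₅ < λ₆`. -/
theorem disk_eigenvalue_structure (R : ℝ) (hR : 0 < R) :
    dirichletEV (disk R) 1 < dirichletEV (disk R) 2 ∧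
    dirichletEV (disk R) 2 = dirichletEV (disk R) 3 ∧
    dirichletEV (disk R) 3 < dirichletEV (disk R) 4 ∧
    dirichletEV (disk R) 4 = dirichletEV (disk R) 5 ∧
    dirichletEV (disk R) 5 < dirichletEV (disk R) 6 := by
  obtain ⟨s0, s1, s2, ν, h0, h01, h12, h2ν, z0, z1, z2, u0, u1, u2, u3⟩ := exists_bes_zeros
  have hR2 : 0 < R ^ 2 := by positivity
  let z : ℕ → ℝ := fun n => if n = 0 then s0 else if n = 1 then s1 else s2
  have upper : ∀ {k : ℕ}, k ≤ 5 → ∀ {T : ℝ}, 0 < T → (∀ j : Fin 5, (j : ℕ) < k → z (tdeg j) ≤ T) →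
      dirichletEV (disk R) k ≤ T / R ^ 2 := by
    intro k hk T hT h
    refine le_of_forall_gt_imp_ge_of_dense fun μ' hμ' => ?_
    have : 0 < T / R ^ 2 := by positivity
    refine dirichletEV_le hR hk (this.trans hμ').le (fun j => z (tdeg j)) (fun j => ?_) (fun j => ?_)
      fun j hj => (div_le_div_of_nonneg_right (h j hj) hR2.le).trans_lt hμ'
    · fin_cases j <;> simp [z, tdeg] <;> linarith
    · fin_cases j <;> simpa [z, tdeg]
  have lower : ∀ {T : ℝ}, 0 < T → T ≤ ν → ∀ {k m : ℕ}, m < k → ∀ J : Fin m → Fin 5,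
      (∀ j, z (tdeg j) < T → ∃ i, J i = j) → T / R ^ 2 ≤ dirichletEV (disk R) k := by
    intro T hT hTν k m hmk J hJ
    have hsub : ∀ s ∈ Ioo 0 T, s ∈ Icc 0 ν := fun s hs => ⟨hs.1.le, hs.2.le.trans hTν⟩
    refine div_sq_le_dirichletEV hR hT (z := z) (fun n hn s hs h => ?_) (fun s hs => u3 s (hsub s hs))
      hmk J hJ
    have hs' := hsub s hs
    interval_cases n
    · have e := u0 s hs' h
      exact ⟨e, fun h' => by linarith [u1 s hs' h']⟩
    · have e := u1 s hs' h
      exact ⟨e, fun h' => by linarith [u2 s hs' h']⟩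
    · exact ⟨u2 s hs' h, u3 s hs'⟩
  have b1 : dirichletEV (disk R) 1 ≤ s0 / R ^ 2 := upper (by norm_num) h0 fun j hj => by
    fin_cases j <;> simp [z, tdeg] at hj ⊢
  have b3 : ∀ k ≤ 3, dirichletEV (disk R) k ≤ s1 / R ^ 2 := fun k hk =>
    upper (by omega) (h0.trans h01) fun j hj => by
      fin_cases j <;> simp [z, tdeg] at hj ⊢ <;> linarith
  have b5 : ∀ k ≤ 5, dirichletEV (disk R) k ≤ s2 / R ^ 2 := fun k hk =>
    upper hk (h0.trans (h01.trans h12)) fun j _ => by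
      fin_cases j <;> simp [z, tdeg] <;> linarith
  have l2 : ∀ k, 1 < k → s1 / R ^ 2 ≤ dirichletEV (disk R) k := fun k hk =>
    lower (h0.trans h01) (h12.trans h2ν).le hk ![0] fun j hj => ⟨0, by
      fin_cases j <;> simp [z, tdeg] at hj ⊢ <;> linarith⟩
  have l4 : ∀ k, 3 < k → s2 / R ^ 2 ≤ dirichletEV (disk R) k := fun k hk =>
    lower (h0.trans (h01.trans h12)) h2ν.le hk (Fin.castLE (by norm_num)) fun j hj => by
      fin_cases j
      · exact ⟨0, rfl⟩
      · exact ⟨1, rfl⟩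
      · exact ⟨2, rfl⟩
      all_goals simp [z, tdeg] at hj
  have l6 : ν / R ^ 2 ≤ dirichletEV (disk R) 6 :=
    lower (by linarith) le_rfl (by norm_num : 5 < 6) id fun j _ => ⟨j, rfl⟩
  have d01 := div_lt_div_of_pos_right h01 hR2
  have d12 := div_lt_div_of_pos_right h12 hR2
  have d2ν := div_lt_div_of_pos_right h2ν hR2
  refine ⟨?_, ?_, ?_, ?_, ?_⟩
  · exact b1.trans_lt (d01.trans_le (l2 2 (by norm_num)))
  · exact le_antisymm ((b3 2 (by norm_num)).trans (l2 3 (by norm_num)))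
      ((b3 3 le_rfl).trans (l2 2 (by norm_num)))
  · exact (b3 3 le_rfl).trans_lt (d12.trans_le (l4 4 (by norm_num)))
  · exact le_antisymm ((b5 4 (by norm_num)).trans (l4 5 (by norm_num)))
      ((b5 5 le_rfl).trans (l4 4 (by norm_num)))
  · exact (b5 5 le_rfl).trans_lt (d2ν.trans_le l6)
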